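/- arXiv:2207.08418 — 5 statements merged into one kernel-verified Lean document; each statement's English description precedes it below -/
import Mathlib

section
/- Fix an integer k ≥ 1 and a permutation σ of {1,…,k}, and let |σ| = k − #σ and Moeb(σ) = ∏_c (−1)^{c−1} Cat_{c−1}, the product running over the cycle lengths c of σ. Then the unitary Weingarten function has the asymptotics Wg(n,σ) = n^{−k−|σ|} Moeb(σ) (1 + O(n^{−2})) as n → ∞; precisely, there exist constants C > 0 and N ≥ k such that for all integers n ≥ N, |n^{k+|σ|} Wg(n,σ) − Moeb(σ)| ≤ C n^{−2}. -/
/-- `cycleCount ρ`: the number of cycles of the permutation `ρ`, counting fixed points. -/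
def cycleCount {k : ℕ} (ρ : Equiv.Perm (Fin k)) : ℕ :=
  ρ.cycleType.card + (Finset.univ.filter fun a : Fin k => ρ a = a).card

/-- The Gram matrix `G_k(n)` indexed by `S_k`, with entries `n^{#(στ⁻¹)}`. -/
noncomputable def gramMatrix (k n : ℕ) :
    Matrix (Equiv.Perm (Fin k)) (Equiv.Perm (Fin k)) ℝ :=
  fun σ τ => (n : ℝ) ^ cycleCount (σ * τ⁻¹)

/-- The unitary Weingarten function `Wg(n,σ) = (G_k(n)⁻¹)_{σ,e}`. -/
noncomputable def Wg (k n : ℕ) (σ : Equiv.Perm (Fin k)) : ℝ :=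
  (gramMatrix k n)⁻¹ σ 1

/-- The Möbius function `Moeb(σ) = ∏_c (−1)^{c−1} Cat_{c−1}`, the product running over
the cycle lengths `c` of `σ` (fixed points contributing a factor `1`). -/
noncomputable def Moeb {k : ℕ} (σ : Equiv.Perm (Fin k)) : ℝ :=
  (σ.cycleType.map fun c => (-1 : ℝ) ^ (c - 1) * (catalan (c - 1) : ℝ)).prod

open Equiv Equiv.Perm Finset

section PermLists

variable {α : Type*} [DecidableEq α]

theorem formPerm_append_cons (l₁ : List α) (y : α) (l₂ : List α) :
    (l₁ ++ y :: l₂).formPerm = (l₁ ++ [y]).formPerm * (y :: l₂).formPerm := by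
  induction l₁ with
  | nil => simp
  | cons x l ih =>
    cases l with
    | nil => simp
    | cons z l => simpa [List.formPerm_cons_cons, mul_assoc] using ih

theorem swap_mul_formPerm_cons {x y : α} {l : List α} (hx : x ∉ l) (hy : y ∉ l) :
    swap x y * (x :: l).formPerm = (y :: l).formPerm * swap x y := by
  cases l with
  | nil => simp
  | cons z l =>
    have hc : Commute (swap x y) (z :: l).formPerm := by
      refine Disjoint.commute fun a => ?_
      by_cases ha : a ∈ z :: l
      · left
        exact swap_apply_of_ne_of_ne (fun h => hx (h ▸ ha)) (fun h => hy (h ▸ ha))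
      · exact Or.inr (List.formPerm_apply_of_notMem ha)
    have hzx : z ≠ x := fun h => hx (by simp [h])
    have hzy : z ≠ y := fun h => hy (by simp [h])
    have hs : swap x y * swap x z = swap y z * swap x y := by
      rw [mul_swap_eq_swap_mul, swap_apply_left, swap_apply_of_ne_of_ne hzx hzy]
    rw [List.formPerm_cons_cons, List.formPerm_cons_cons, ← mul_assoc, hs, mul_assoc, mul_assoc,
      hc.eq]

/-- Multiplying a cycle by the transposition of two of its entries cuts it in two. -/
theorem formPerm_mul_swap {x y : α} {l₁ l₂ : List α} (h : (x :: (l₁ ++ y :: l₂)).Nodup) :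
    (x :: (l₁ ++ y :: l₂)).formPerm * swap x y = (y :: l₁).formPerm * (x :: l₂).formPerm := by
  have hx : x ∉ l₁ ∧ x ≠ y ∧ x ∉ l₂ := by simp at h; tauto
  have hy : y ∉ l₁ ∧ y ∉ l₂ := by
    simp only [List.nodup_cons, List.nodup_append, List.nodup_cons] at h
    exact ⟨fun hm => h.2.2.2 y hm y (by simp) rfl, h.2.2.1.1⟩
  have hr : (x :: (l₁ ++ [y])).formPerm = (y :: x :: l₁).formPerm := by
    symm
    refine List.formPerm_eq_of_isRotated ?_ ⟨1, by simp⟩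
    simp only [List.nodup_cons, List.nodup_append] at h
    simp only [List.nodup_cons, List.mem_cons]
    refine ⟨fun hh => hh.elim (fun e => hx.2.1 e.symm) hy.1, hx.1, h.2.1⟩
  have hs := formPerm_append_cons (x :: l₁) y l₂
  rw [List.cons_append, List.cons_append] at hs
  rw [hs, hr, List.formPerm_cons_cons, swap_comm y x, swap_mul_formPerm_cons hx.1 hy.1, mul_assoc,
    mul_assoc, ← swap_mul_formPerm_cons hx.2.2 hy.2, ← mul_assoc (swap x y), swap_mul_self, one_mul]

theorem mul_swap_same (u : Perm α) (x : α) : u * swap x x = u := by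
  ext; simp

theorem disjoint_formPerm {l : List α} {r : Perm α} (h : ∀ a ∈ l, r a = a) :
    Disjoint l.formPerm r := fun a => by
  by_cases ha : a ∈ l
  · exact Or.inr (h a ha)
  · exact Or.inl (List.formPerm_apply_of_notMem ha)

/-- A cycle through `x` and `y`, split at `y`, together with the cycles it is cut into. -/
theorem formPerm_mul_mul_swap_disjoint {x y : α} {l₁ l₂ : List α} {r : Perm α}
    (h : (x :: (l₁ ++ y :: l₂)).Nodup) (hr : ∀ a ∈ x :: (l₁ ++ y :: l₂), r a = a) :
    ((x :: (l₁ ++ y :: l₂)).formPerm * r) * swap x y =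
        (y :: l₁).formPerm * ((x :: l₂).formPerm * r) ∧
      (y :: l₁).Nodup ∧ (x :: l₂).Nodup ∧ Disjoint (x :: l₂).formPerm r ∧
      Disjoint (y :: l₁).formPerm ((x :: l₂).formPerm * r) := by
  have hN := h
  simp only [List.nodup_cons, List.nodup_append, List.mem_append, List.mem_cons] at h
  have hs : Disjoint (swap x y) r := fun a => by
    by_cases ha : a = x ∨ a = y
    · exact Or.inr (hr a (by simp; tauto))
    · push Not at ha
      exact Or.inl (swap_apply_of_ne_of_ne ha.1 ha.2)
  refine ⟨?_, ?_, ?_, ?_, ?_⟩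
  · rw [mul_assoc, ← hs.commute.eq, ← mul_assoc, formPerm_mul_swap hN, mul_assoc]
  · exact List.nodup_cons.mpr ⟨fun hm => h.2.2.2 y hm y (by simp) rfl, h.2.1⟩
  · exact List.nodup_cons.mpr ⟨by tauto, h.2.2.1.2⟩
  · exact disjoint_formPerm fun a ha => hr a (by simp at ha ⊢; tauto)
  · refine disjoint_formPerm fun a ha => ?_
    rw [Perm.mul_apply, hr a (by simp at ha ⊢; tauto)]
    refine List.formPerm_apply_of_notMem fun ha' => ?_
    simp only [List.mem_cons] at ha ha'
    rcases ha with rfl | ha <;> rcases ha' with rfl | ha'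
    · tauto
    · tauto
    · tauto
    · exact h.2.2.2 a ha a (by tauto) rfl

variable [Fintype α]

theorem cycleType_formPerm_cons {x : α} {l : List α} (h : (x :: l).Nodup) :
    (x :: l).formPerm.cycleType = if l = [] then 0 else {l.length + 1} := by
  split_ifs with hl
  · simp [hl]
  · have h2 : 2 ≤ (x :: l).length := by
      have := List.length_pos_iff.mpr hl
      simp; lia
    rw [(List.isCycle_formPerm h h2).cycleType, List.support_formPerm_of_nodup _ h,
      List.toFinset_card_of_nodup h, List.length_cons]
    rintro y hy
    simp [hy] at h2

theorem exists_eq_formPerm_mul (u : Perm α) (x : α) :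
    ∃ (l : List α) (r : Perm α), (x :: l).Nodup ∧ u = (x :: l).formPerm * r ∧
      ∀ a ∈ x :: l, r a = a := by
  by_cases hx : u x = x
  · exact ⟨[], u, by simp, by simp, by simpa using hx⟩
  · have hx' : x ∈ u.support := mem_support.mpr hx
    obtain ⟨l, hl⟩ : ∃ l, u.toList x = x :: l := by
      have h0 := toList_getElem_zero (h := hx')
      cases hL : u.toList x with
      | nil => exact absurd hx' (toList_eq_nil_iff.mp hL)
      | cons b l =>
        simp only [hL, List.getElem_cons_zero] at h0
        exact ⟨l, by rw [h0]⟩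
    refine ⟨l, (x :: l).formPerm⁻¹ * u, hl ▸ nodup_toList u x, by simp, fun a ha => ?_⟩
    rw [← hl] at ha ⊢
    rw [formPerm_toList, Perm.mul_apply, inv_eq_iff_eq, (mem_toList_iff.mp ha).1.cycleOf_apply]

/-- The minimal number of transpositions whose product is `σ`. -/
def cycleRank (σ : Perm α) : ℕ := (σ.cycleType.map fun c => c - 1).sum

theorem cycleRank_one : cycleRank (1 : Perm α) = 0 := by simp [cycleRank]

theorem cycleRank_conj (σ τ : Perm α) : cycleRank (τ * σ * τ⁻¹) = cycleRank σ := by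
  simp [cycleRank, cycleType_conj]

theorem cycleRank_mul_comm (σ τ : Perm α) : cycleRank (σ * τ) = cycleRank (τ * σ) := by
  rw [← cycleRank_conj (τ * σ) σ]; congr 1; group

theorem cycleRank_disjoint_mul {σ τ : Perm α} (h : Disjoint σ τ) :
    cycleRank (σ * τ) = cycleRank σ + cycleRank τ := by
  simp [cycleRank, h.cycleType_mul]

theorem cycleRank_formPerm_cons {x : α} {l : List α} (h : (x :: l).Nodup) :
    cycleRank (x :: l).formPerm = l.length := by
  rw [cycleRank, cycleType_formPerm_cons h]
  split_ifs with hl <;> simp [hl]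

theorem sum_cycleType_eq (σ : Perm α) :
    σ.cycleType.sum = cycleRank σ + σ.cycleType.card := by
  have h : ∀ s : Multiset ℕ, (∀ c ∈ s, 2 ≤ c) →
      s.sum = (s.map fun c => c - 1).sum + s.card := by
    intro s
    induction s using Multiset.induction with
    | empty => simp
    | cons a s ih =>
      intro hs
      have h1 := hs a (by simp)
      have h2 := ih fun c hc => hs c (by simp [hc])
      simp only [Multiset.sum_cons, Multiset.map_cons, Multiset.card_cons]
      lia
  exact h _ fun c hc => two_le_of_mem_cycleType hc

theorem sign_eq_neg_one_pow_cycleRank (σ : Perm α) : sign σ = (-1) ^ cycleRank σ := by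
  rw [sign_of_cycleType, sum_cycleType_eq, add_assoc, pow_add, ← two_mul, pow_mul]
  simp

theorem cycleRank_cut {x y : α} {l₁ l₂ : List α} {r : Perm α}
    (h : (x :: (l₁ ++ y :: l₂)).Nodup) (hr : ∀ a ∈ x :: (l₁ ++ y :: l₂), r a = a) :
    cycleRank (((x :: (l₁ ++ y :: l₂)).formPerm * r) * swap x y) + 1 =
      cycleRank ((x :: (l₁ ++ y :: l₂)).formPerm * r) := by
  obtain ⟨h1, h2, h3, h4, h5⟩ := formPerm_mul_mul_swap_disjoint h hr
  rw [h1, cycleRank_disjoint_mul h5, cycleRank_disjoint_mul h4, cycleRank_formPerm_cons h2,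
    cycleRank_formPerm_cons h3, cycleRank_disjoint_mul (disjoint_formPerm hr),
    cycleRank_formPerm_cons h]
  simp
  lia

theorem cycleRank_join {x y : α} {l : List α} {r : Perm α} (h : (x :: l).Nodup)
    (hr : ∀ a ∈ x :: l, r a = a) (hy : y ∉ x :: l) :
    cycleRank (((x :: l).formPerm * r) * swap x y) = cycleRank ((x :: l).formPerm * r) + 1 := by
  obtain ⟨m, s, hm, rfl, hs⟩ := exists_eq_formPerm_mul r y
  have hd : ∀ a ∈ x :: l, a ∉ y :: m := by
    intro a ha ha'
    have h1 := hr a ha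
    rw [Perm.mul_apply, hs a ha', List.formPerm_apply_mem_eq_self_iff _ hm a ha'] at h1
    have : m = [] := by simpa using h1
    subst this
    simp only [List.mem_singleton] at ha'
    exact hy (ha' ▸ ha)
  have hs' : ∀ a ∈ x :: l, s a = a := fun a ha => by
    refine (y :: m).formPerm.injective ?_
    rw [← Perm.mul_apply, hr a ha, List.formPerm_apply_of_notMem (hd a ha)]
  have hc : Commute (x :: l).formPerm (y :: m).formPerm :=
    (disjoint_formPerm fun a ha => List.formPerm_apply_of_notMem (hd a ha)).commute
  have hN : (x :: (m ++ y :: l)).Nodup := by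
    have hx := hd x (by simp)
    have hl : ∀ a ∈ l, a ∉ y :: m := fun a ha => hd a (by simp [ha])
    simp only [List.nodup_cons, List.nodup_append, List.mem_append, List.mem_cons, not_or]
      at h hm hx hy hl ⊢
    refine ⟨⟨hx.2, hx.1, h.1⟩, hm.2, ⟨hy.2, h.2⟩, ?_⟩
    rintro a ha b (rfl | hb) rfl
    · exact hm.1 ha
    · exact (hl _ hb).2 ha
  have hR : ∀ a ∈ x :: (m ++ y :: l), s a = a := by
    intro a ha
    by_cases h' : a ∈ x :: l
    · exact hs' a h'
    · refine hs a ?_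
      simp only [List.mem_append, List.mem_cons] at ha h' ⊢
      tauto
  have hcut := (formPerm_mul_mul_swap_disjoint hN hR).1
  rw [← mul_assoc (y :: m).formPerm, ← hc.eq, mul_assoc (x :: l).formPerm] at hcut
  rw [← hcut, cycleRank_cut hN hR, mul_assoc _ (swap x y), swap_mul_self, mul_one]

theorem cycleRank_mul_swap_le (u : Perm α) (x y : α) :
    cycleRank (u * swap x y) ≤ cycleRank u + 1 := by
  by_cases hxy : x = y
  · rw [hxy, mul_swap_same]
    lia
  obtain ⟨l, r, h, rfl, hr⟩ := exists_eq_formPerm_mul u x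
  by_cases hy : y ∈ l
  · obtain ⟨l₁, l₂, rfl⟩ := List.append_of_mem hy
    have := cycleRank_cut h hr
    lia
  · exact (cycleRank_join h hr (by simp [hy, Ne.symm hxy])).le

theorem cycleRank_mul_swap_of_apply_eq {u : Perm α} {x y : α} (hxy : x ≠ y) (hu : u x = x) :
    cycleRank (u * swap x y) = cycleRank u + 1 := by
  have := cycleRank_join (l := []) (x := x) (y := y) (r := u) (by simp) (by simpa using hu)
    (by simpa using hxy.symm)
  simpa using this

theorem exists_cycleRank_mul_swap_lt {u : Perm α} (hu : u ≠ 1) :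
    ∃ x y, cycleRank (u * swap x y) + 1 = cycleRank u := by
  obtain ⟨x, hx⟩ : ∃ x, u x ≠ x := by
    by_contra! h
    exact hu (Equiv.ext h)
  obtain ⟨l, r, h, rfl, hr⟩ := exists_eq_formPerm_mul u x
  cases l with
  | nil => simp at hr hx; exact absurd hr hx
  | cons y l => exact ⟨x, y, cycleRank_cut (l₁ := []) h hr⟩

theorem cycleRank_mul_le (σ τ : Perm α) :
    cycleRank (σ * τ) ≤ cycleRank σ + cycleRank τ := by
  induction hn : cycleRank τ generalizing τ with
  | zero =>
    have : τ = 1 := by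
      by_contra h
      obtain ⟨x, y, h⟩ := exists_cycleRank_mul_swap_lt h
      lia
    simp [this]
  | succ n ih =>
    have h1 : τ ≠ 1 := by
      rintro rfl
      simp [cycleRank_one] at hn
    obtain ⟨x, y, h⟩ := exists_cycleRank_mul_swap_lt h1
    have h2 := ih (τ * swap x y) (by lia)
    have h3 := cycleRank_mul_swap_le (σ * (τ * swap x y)) x y
    rw [← mul_assoc σ, mul_assoc _ (swap x y), swap_mul_self, mul_one] at h3
    rw [← mul_assoc σ] at h2
    lia

theorem cycleRank_eq_zero {σ : Perm α} : cycleRank σ = 0 ↔ σ = 1 := by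
  refine ⟨fun h => ?_, fun h => h ▸ cycleRank_one⟩
  by_contra hσ
  obtain ⟨x, y, h'⟩ := exists_cycleRank_mul_swap_lt hσ
  lia

theorem cycleRank_parity (σ τ : Perm α) :
    Even (cycleRank (σ * τ⁻¹) + cycleRank τ + cycleRank σ) := by
  have h : (-1 : ℤˣ) ^ (cycleRank (σ * τ⁻¹) + cycleRank τ + cycleRank σ) = 1 := by
    rw [pow_add, pow_add, ← sign_eq_neg_one_pow_cycleRank, ← sign_eq_neg_one_pow_cycleRank,
      ← sign_eq_neg_one_pow_cycleRank, ← Perm.sign_mul, ← Perm.sign_mul]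
    simp
  by_contra ho
  rw [Nat.not_even_iff_odd] at ho
  rw [ho.neg_one_pow] at h
  exact absurd h (by decide)

end PermLists

section Moebius

variable {k : ℕ}

theorem cycleCount_add_cycleRank (σ : Perm (Fin k)) : cycleCount σ + cycleRank σ = k := by
  have h1 := sum_cycleType_eq σ
  rw [sum_cycleType] at h1
  have h2 : (univ.filter fun a : Fin k => σ a = a) = σ.supportᶜ := by
    ext; simp
  have h3 : #σ.supportᶜ + #σ.support = k := by
    rw [card_compl_add_card, Fintype.card_fin]
  rw [cycleCount, h2]
  lia

theorem Moeb_one : Moeb (1 : Perm (Fin k)) = 1 := by simp [Moeb]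

theorem Moeb_disjoint_mul {σ τ : Perm (Fin k)} (h : Disjoint σ τ) :
    Moeb (σ * τ) = Moeb σ * Moeb τ := by
  simp [Moeb, h.cycleType_mul]

theorem Moeb_formPerm_cons {x : Fin k} {l : List (Fin k)} (h : (x :: l).Nodup) :
    Moeb (x :: l).formPerm = (-1) ^ l.length * (catalan l.length : ℝ) := by
  rw [Moeb, cycleType_formPerm_cons h]
  split_ifs with hl <;> simp [hl]

theorem sum_signed_catalan (n : ℕ) :
    ∑ i : Fin n, ((-1) ^ (i : ℕ) * (catalan i : ℝ)) *
      ((-1) ^ (n - 1 - i) * (catalan (n - 1 - i) : ℝ)) =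
    if n = 0 then 0 else -((-1) ^ n * (catalan n : ℝ)) := by
  cases n with
  | zero => simp
  | succ n =>
    rw [if_neg (by simp), catalan_succ, Nat.cast_sum, mul_sum, ← sum_neg_distrib]
    refine sum_congr rfl fun i _ => ?_
    have : (-1 : ℝ) ^ (i : ℕ) * (-1) ^ (n - i) = (-1) ^ n := by
      rw [← pow_add]; congr 1; lia
    rw [Nat.add_sub_cancel, pow_succ, ← this]
    push_cast
    ring

theorem Moeb_add_sum_cut {u : Perm (Fin k)} {x : Fin k} (hx : u x ≠ x) :
    Moeb u + ∑ i, (if cycleRank (u * swap x i) + 1 = cycleRank u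
      then Moeb (u * swap x i) else 0) = 0 := by
  obtain ⟨l, r, h, rfl, hr⟩ := exists_eq_formPerm_mul u x
  set u := (x :: l).formPerm * r with hu
  have hl : l.length ≠ 0 := by
    intro h0
    rw [List.length_eq_zero_iff.mp h0] at hu hr
    simp at hr
    simp [hu, hr] at hx
  have hmem : ∀ i, i ∉ l → cycleRank (u * swap x i) + 1 ≠ cycleRank u := by
    intro i hi
    by_cases hix : i = x
    · rw [hix, mul_swap_same]
      lia
    · have := cycleRank_join h hr (y := i) (by simp [hix, hi])
      lia
  have hcut : ∀ j : Fin l.length,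
      (if cycleRank (u * swap x l[(j : ℕ)]) + 1 = cycleRank u
        then Moeb (u * swap x l[(j : ℕ)]) else 0) =
      (((-1) ^ (j : ℕ) * (catalan j : ℝ)) *
      ((-1) ^ (l.length - 1 - j) * (catalan (l.length - 1 - j) : ℝ))) * Moeb r := by
    intro j
    obtain ⟨y, hy⟩ : ∃ y, y = l[(j : ℕ)] := ⟨_, rfl⟩
    have hsplit : l = l.take j ++ y :: l.drop (j + 1) := by
      rw [hy, ← List.drop_eq_getElem_cons, List.take_append_drop]
    rw [← hy]
    have h' := h
    have hr' := hr
    rw [hsplit] at h' hr'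
    have hrank := cycleRank_cut h' hr'
    obtain ⟨h1, h2, h3, h4, h5⟩ := formPerm_mul_mul_swap_disjoint h' hr'
    rw [← hsplit] at h1 hrank
    rw [if_pos hrank, h1, Moeb_disjoint_mul h5, Moeb_disjoint_mul h4, Moeb_formPerm_cons h2,
      Moeb_formPerm_cons h3, List.length_take, List.length_drop, min_eq_left j.2.le, ← mul_assoc,
      Nat.add_comm, Nat.sub_add_eq]
  rw [← sum_subset (subset_univ l.toFinset) fun i _ hi => if_neg (hmem i (by simpa using hi)),
    List.sum_toFinset _ h.of_cons, ← Fin.sum_univ_fun_getElem, sum_congr rfl fun j _ => hcut j,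
    ← sum_mul, sum_signed_catalan, if_neg hl, Moeb_disjoint_mul (disjoint_formPerm hr),
    Moeb_formPerm_cons h]
  ring

/-- `Moeb` is the Möbius function of the absolute order on the symmetric group. -/
theorem sum_Moeb (σ : Perm (Fin k)) :
    ∑ τ, (if cycleRank (σ * τ⁻¹) + cycleRank τ = cycleRank σ then Moeb τ else 0) =
      if σ = 1 then 1 else 0 := by
  have hcomm : ∀ τ : Perm (Fin k), cycleRank (σ * τ⁻¹) = cycleRank (τ⁻¹ * σ) :=
    fun τ => cycleRank_mul_comm _ _
  split_ifs with hσ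
  · subst hσ
    rw [sum_eq_single 1]
    · simp [cycleRank_one, Moeb_one]
    · intro τ _ hτ
      have := cycleRank_eq_zero.not.mpr hτ
      rw [if_neg (by rw [cycleRank_one]; lia)]
    · simp
  · obtain ⟨x, hx⟩ : ∃ x, σ x ≠ x := by
      by_contra! h
      exact hσ (Equiv.ext h)
    simp only [hcomm]
    set F : Perm (Fin k) → ℝ := fun τ =>
      if cycleRank (τ⁻¹ * σ) + cycleRank τ = cycleRank σ then Moeb τ else 0 with hF
    change ∑ τ, F τ = 0
    have h1 : ∀ τ, F τ = ∑ i, if τ i = σ x then F τ else 0 := by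
      intro τ
      rw [sum_eq_single (τ⁻¹ (σ x))]
      · simp
      · rintro i - hi
        exact if_neg fun h => hi (by simp [← h])
      · simp
    have h2 : ∀ i, (∑ τ : Perm (Fin k), if τ i = σ x then F τ else 0) =
        ∑ u : Perm (Fin k), if u x = σ x then F (u * swap x i) else 0 := by
      intro i
      rw [← Equiv.sum_comp (Equiv.mulRight (swap x i))]
      simp
    rw [sum_congr rfl fun τ _ => h1 τ, sum_comm, sum_congr rfl fun i _ => h2 i, sum_comm]
    refine sum_eq_zero fun u _ => ?_
    by_cases hu : u x = σ x
    swap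
    · simp [hu]
    simp only [hu, if_true]
    have hw : (u⁻¹ * σ) x = x := by simp [← hu]
    have hlow : cycleRank σ ≤ cycleRank u + cycleRank (u⁻¹ * σ) := by
      simpa using cycleRank_mul_le u (u⁻¹ * σ)
    have hrank : ∀ i, i ≠ x →
        cycleRank ((u * swap x i)⁻¹ * σ) = cycleRank (u⁻¹ * σ) + 1 := by
      intro i hi
      rw [← cycleRank_mul_swap_of_apply_eq hi.symm hw, mul_inv_rev, swap_inv, mul_assoc,
        cycleRank_mul_comm]
    have hstep : ∀ i, cycleRank u ≤ cycleRank (u * swap x i) + 1 := by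
      intro i
      simpa [mul_assoc] using cycleRank_mul_swap_le (u * swap x i) x i
    rw [← add_sum_erase _ _ (mem_univ x)]
    by_cases hgeo : cycleRank u + cycleRank (u⁻¹ * σ) = cycleRank σ
    · have h := Moeb_add_sum_cut (u := u) (x := x) (by rwa [hu])
      rw [← add_sum_erase _ _ (mem_univ x)] at h
      simp only [mul_swap_same, Nat.add_eq_left, one_ne_zero, if_false,
        zero_add] at h
      rw [← h, mul_swap_same]
      simp only [hF]
      congr 1
      · rw [if_pos (by lia)]
      · refine sum_congr rfl fun i hi => if_congr ?_ rfl rfl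
        rw [hrank i (ne_of_mem_erase hi)]
        lia
    · rw [mul_swap_same]
      simp only [hF]
      rw [if_neg (by lia), zero_add]
      refine sum_eq_zero fun i hi => if_neg ?_
      have h1 := hstep i
      rw [hrank i (ne_of_mem_erase hi)]
      lia

end Moebius

open Matrix

section Asymptotics

variable {k : ℕ}

/-- The zeta matrix of the absolute order on the symmetric group. -/
noncomputable def zetaMatrix (k : ℕ) : Matrix (Perm (Fin k)) (Perm (Fin k)) ℝ :=
  fun σ τ => if cycleRank (σ * τ⁻¹) + cycleRank τ = cycleRank σ then 1 else 0

/-- The Gram matrix, rescaled so that it converges to the zeta matrix. -/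
noncomputable def scaledGram (k n : ℕ) : Matrix (Perm (Fin k)) (Perm (Fin k)) ℝ :=
  fun σ τ => (n : ℝ) ^ cycleRank σ / (n : ℝ) ^ (cycleRank (σ * τ⁻¹) + cycleRank τ)

theorem zetaMatrix_mulVec_Moeb : zetaMatrix k *ᵥ Moeb = Pi.single 1 1 := by
  ext σ
  rw [Pi.single_apply, ← sum_Moeb σ]
  simp [mulVec, dotProduct, zetaMatrix]

theorem zetaMatrix_injective {v : Perm (Fin k) → ℝ} (hv : zetaMatrix k *ᵥ v = 0) : v = 0 := by
  ext σ
  induction hn : cycleRank σ using Nat.strong_induction_on generalizing σ with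
  | _ n ih =>
    have h := congrFun hv σ
    simp only [mulVec, dotProduct, zetaMatrix, ite_mul, one_mul, zero_mul, Pi.zero_apply] at h
    rwa [sum_eq_single σ, if_pos (by simp [cycleRank_one])] at h
    · intro τ _ hτ
      split_ifs with hr
      · have h0 : cycleRank (σ * τ⁻¹) ≠ 0 := fun h0 =>
          hτ (mul_inv_eq_one.mp (cycleRank_eq_zero.mp h0)).symm
        exact ih _ (by lia) τ rfl
      · rfl
    · simp

theorem abs_zetaMatrix_sub_scaledGram_le {n : ℕ} (hn : 1 ≤ n) (σ τ : Perm (Fin k)) :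
    |zetaMatrix k σ τ - scaledGram k n σ τ| ≤ 1 / (n : ℝ) ^ 2 := by
  have hn1 : (1 : ℝ) ≤ n := by exact_mod_cast hn
  have hn0 : (0 : ℝ) < n := by linarith
  rw [zetaMatrix, scaledGram]
  split_ifs with h
  · rw [h, div_self (by positivity), sub_self, abs_zero]
    positivity
  · have h1 : cycleRank σ ≤ cycleRank (σ * τ⁻¹) + cycleRank τ := by
      simpa using cycleRank_mul_le (σ * τ⁻¹) τ
    obtain ⟨c, hc⟩ := cycleRank_parity σ τ
    rw [zero_sub, abs_neg, abs_of_nonneg (by positivity), div_le_div_iff₀ (by positivity)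
      (by positivity), one_mul, ← pow_add]
    exact pow_le_pow_right₀ hn1 (by lia)

theorem norm_zetaMatrix_sub_scaledGram_mulVec_le {n : ℕ} (hn : 1 ≤ n) (v : Perm (Fin k) → ℝ) :
    ‖zetaMatrix k *ᵥ v - scaledGram k n *ᵥ v‖ ≤
      Fintype.card (Perm (Fin k)) / (n : ℝ) ^ 2 * ‖v‖ := by
  rw [← sub_mulVec, pi_norm_le_iff_of_nonneg (by positivity)]
  intro σ
  calc ‖((zetaMatrix k - scaledGram k n) *ᵥ v) σ‖
      ≤ ∑ τ, ‖(zetaMatrix k - scaledGram k n) σ τ * v τ‖ := norm_sum_le _ _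
    _ ≤ ∑ _τ : Perm (Fin k), 1 / (n : ℝ) ^ 2 * ‖v‖ := by
      refine sum_le_sum fun τ _ => ?_
      rw [norm_mul]
      exact mul_le_mul (abs_zetaMatrix_sub_scaledGram_le hn σ τ) (norm_le_pi_norm v τ)
        (norm_nonneg _) (by positivity)
    _ = _ := by
      rw [sum_const, card_univ, nsmul_eq_mul]
      ring

theorem exists_norm_le_zetaMatrix_mulVec (k : ℕ) :
    ∃ K : ℝ, 0 < K ∧ ∀ v : Perm (Fin k) → ℝ, ‖v‖ ≤ K * ‖zetaMatrix k *ᵥ v‖ := by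
  obtain ⟨K, hK, h⟩ := LinearMap.exists_antilipschitzWith (Matrix.toLin' (zetaMatrix k))
    (LinearMap.ker_eq_bot'.mpr fun v hv => zetaMatrix_injective (by simpa using hv))
  refine ⟨K, by exact_mod_cast hK, fun v => ?_⟩
  have := h.le_mul_dist v 0
  rwa [map_zero, dist_zero_right, dist_zero_right, Matrix.toLin'_apply] at this

theorem scaledGram_mulVec {n : ℕ} (hn : 1 ≤ n) (w : Perm (Fin k) → ℝ) (σ : Perm (Fin k)) :
    (scaledGram k n *ᵥ fun τ => (n : ℝ) ^ (k + cycleRank τ) * w τ) σ =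
      (n : ℝ) ^ cycleRank σ * (gramMatrix k n *ᵥ w) σ := by
  have hn0 : (n : ℝ) ≠ 0 := by exact_mod_cast (by lia : n ≠ 0)
  simp only [mulVec, dotProduct, mul_sum]
  refine sum_congr rfl fun τ _ => ?_
  have h : (n : ℝ) ^ k = (n : ℝ) ^ cycleCount (σ * τ⁻¹) * (n : ℝ) ^ cycleRank (σ * τ⁻¹) := by
    rw [← pow_add, cycleCount_add_cycleRank]
  rw [scaledGram, gramMatrix, pow_add _ k, h, pow_add]
  field_simp

theorem gramMatrix_mulVec_Wg {n : ℕ} (h : (gramMatrix k n).det ≠ 0) :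
    gramMatrix k n *ᵥ Wg k n = Pi.single 1 1 := by
  ext σ
  have := congrFun (congrFun (Matrix.mul_nonsing_inv _ (isUnit_iff_ne_zero.mpr h)) σ) 1
  rw [Matrix.one_apply] at this
  rw [Pi.single_apply, ← this]
  rfl

end Asymptotics

/-- First-order asymptotics of the unitary Weingarten function:
`Wg(n,σ) = n^{−k−|σ|} Moeb(σ) (1 + O(n^{−2}))` with `|σ| = k − #σ`. -/
theorem stmt12 (k : ℕ) (hk : 1 ≤ k) (σ : Equiv.Perm (Fin k)) :
    ∃ C : ℝ, 0 < C ∧ ∃ N : ℕ, k ≤ N ∧ ∀ n : ℕ, N ≤ n →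
      |(n : ℝ) ^ (k + (k - cycleCount σ)) * Wg k n σ - Moeb σ| ≤ C / (n : ℝ) ^ 2 := by
  obtain ⟨K, hK, hKv⟩ := exists_norm_le_zetaMatrix_mulVec k
  set c : ℝ := K * Fintype.card (Perm (Fin k)) with hc
  have hc0 : 0 ≤ c := by positivity
  set m : ℝ := ‖(Moeb : Perm (Fin k) → ℝ)‖ with hm
  have hm0 : 0 ≤ m := norm_nonneg _
  refine ⟨2 * c * m + 1, by positivity, max k (⌈2 * c⌉₊ + 1), le_max_left _ _, fun n hn => ?_⟩
  have hn1 : 1 ≤ n := hk.trans ((le_max_left _ _).trans hn)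
  have hn1' : (1 : ℝ) ≤ n := by exact_mod_cast hn1
  have hnc : 2 * c + 1 ≤ n := by
    have h1 := Nat.le_ceil (2 * c)
    have h2 : ((⌈2 * c⌉₊ + 1 : ℕ) : ℝ) ≤ n := by exact_mod_cast (le_max_right _ _).trans hn
    push_cast at h2
    linarith
  have hn0 : (0 : ℝ) < n := by linarith
  have hsq : 2 * c + 1 ≤ (n : ℝ) ^ 2 := by nlinarith
  have hhalf : c / (n : ℝ) ^ 2 ≤ 1 / 2 := by
    rw [div_le_div_iff₀ (by positivity) (by norm_num)]
    linarith
  have hpert : ∀ v : Perm (Fin k) → ℝ,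
      K * ‖zetaMatrix k *ᵥ v - scaledGram k n *ᵥ v‖ ≤ c / (n : ℝ) ^ 2 * ‖v‖ := fun v =>
    (mul_le_mul_of_nonneg_left (norm_zetaMatrix_sub_scaledGram_mulVec_le hn1 v) hK.le).trans_eq
      (by rw [hc]; ring)
  have hdet : (gramMatrix k n).det ≠ 0 := by
    intro h0
    obtain ⟨w, hw0, hw⟩ := Matrix.exists_mulVec_eq_zero_iff.mpr h0
    set v : Perm (Fin k) → ℝ := fun τ => (n : ℝ) ^ (k + cycleRank τ) * w τ with hv
    have hAv : scaledGram k n *ᵥ v = 0 := by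
      ext τ
      rw [hv, scaledGram_mulVec hn1, hw]
      simp
    have h1 := hpert v
    rw [hAv, sub_zero] at h1
    have h2 := hKv v
    have h3 : c / (n : ℝ) ^ 2 * ‖v‖ ≤ 1 / 2 * ‖v‖ :=
      mul_le_mul_of_nonneg_right hhalf (norm_nonneg _)
    have h4 : ‖v‖ = 0 := le_antisymm (by linarith) (norm_nonneg _)
    refine hw0 (funext fun τ => ?_)
    have h5 := congrFun (norm_eq_zero.mp h4) τ
    simpa [hv, hn0.ne'] using h5
  set f : Perm (Fin k) → ℝ := fun τ => (n : ℝ) ^ (k + cycleRank τ) * Wg k n τ with hf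
  have hAf : scaledGram k n *ᵥ f = Pi.single 1 1 := by
    ext τ
    rw [hf, scaledGram_mulVec hn1, gramMatrix_mulVec_Wg hdet, Pi.single_apply]
    split_ifs with h
    · simp [h, cycleRank_one]
    · simp
  have h1 : ‖f - Moeb‖ ≤ c / (n : ℝ) ^ 2 * ‖f‖ := by
    refine (hKv _).trans ?_
    rw [mulVec_sub, zetaMatrix_mulVec_Moeb, ← hAf]
    exact hpert f
  have h2 : ‖f‖ ≤ 2 * m := by
    have h3 : ‖f‖ ≤ ‖f - Moeb‖ + m := by
      have := norm_add_le (f - Moeb) Moeb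
      rwa [sub_add_cancel] at this
    have h4 : c / (n : ℝ) ^ 2 * ‖f‖ ≤ 1 / 2 * ‖f‖ :=
      mul_le_mul_of_nonneg_right hhalf (norm_nonneg _)
    linarith
  have hrank : k - cycleCount σ = cycleRank σ := by
    have := cycleCount_add_cycleRank σ
    lia
  rw [hrank]
  calc |(n : ℝ) ^ (k + cycleRank σ) * Wg k n σ - Moeb σ|
      ≤ ‖f - Moeb‖ := norm_le_pi_norm (f - Moeb) σ
    _ ≤ c / (n : ℝ) ^ 2 * (2 * m) := h1.trans (mul_le_mul_of_nonneg_left h2 (by positivity))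
    _ = 2 * c * m / (n : ℝ) ^ 2 := by ring
    _ ≤ _ := by gcongr; linarith
end

section
/- Fix integers k₁, k₂ ≥ 1, permutations σ₁ of {1,…,k₁} and σ₂ of {1,…,k₂}, and let σ = σ₁ ⊔ σ₂ be the permutation of {1,…,k₁+k₂} acting as σ₁ on {1,…,k₁} and as σ₂ (shifted) on {k₁+1,…,k₁+k₂}. Then the unitary Weingarten function is almost multiplicative: Wg(n, σ) = Wg(n, σ₁) · Wg(n, σ₂) · (1 + O(n^{−2})) as n → ∞; precisely, there exist constants C > 0 and N such that for all integers n ≥ N, Wg(n,σ₁)Wg(n,σ₂) ≠ 0 and |Wg(n,σ)/(Wg(n,σ₁)Wg(n,σ₂)) − 1| ≤ C n^{−2}. -/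
/-- The disjoint sum `σ₁ ⊔ σ₂ ∈ S_{k₁+k₂}` of `σ₁ ∈ S_{k₁}` and `σ₂ ∈ S_{k₂}`,
acting as `σ₁` on the first `k₁` points and as a shifted copy of `σ₂` on the rest. -/
def disjointSum {k₁ k₂ : ℕ} (σ₁ : Equiv.Perm (Fin k₁)) (σ₂ : Equiv.Perm (Fin k₂)) :
    Equiv.Perm (Fin (k₁ + k₂)) :=
  (finSumFinEquiv.permCongr) (Equiv.Perm.sumCongr σ₁ σ₂)

section helpers

open Equiv

/-- The number of cycles of a permutation of a finite type, counting fixed points. -/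
def numCycles {α : Type} [Fintype α] [DecidableEq α] (σ : Perm α) : ℕ :=
  σ.cycleType.card + (Finset.univ.filter fun a : α => σ a = a).card

/-- The space of real functions that are constant on the cycles of `σ`. -/
def fixSpace {α : Type} (σ : Perm α) : Submodule ℝ (α → ℝ) where
  carrier := {f | ∀ x, f (σ x) = f x}
  add_mem' hf hg x := by simp [hf x, hg x]
  zero_mem' x := rfl
  smul_mem' c f hf x := by simp [hf x]

/-- Functions taking the same value at `a` and `b`. -/
def eqSpace {α : Type} (a b : α) : Submodule ℝ (α → ℝ) :=
  LinearMap.ker (LinearMap.proj (R := ℝ) (φ := fun _ : α => ℝ) a - LinearMap.proj b)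

lemma mem_eqSpace {α : Type} {a b : α} {f : α → ℝ} : f ∈ eqSpace a b ↔ f a = f b := by
  simp [eqSpace, sub_eq_zero]

lemma fixSpace_inf_eqSpace_le {α : Type} [DecidableEq α] (a b : α) (σ : Perm α) :
    fixSpace σ ⊓ eqSpace a b ≤ fixSpace (swap a b * σ) := by
  rintro f ⟨hf, hE⟩ x
  have hE := mem_eqSpace.1 hE
  rw [Perm.mul_apply, ← hf x, swap_apply_def]
  split_ifs with h1 h2
  · rw [h1, hE]
  · rw [h2, hE]
  · rfl

section cycles

variable {α β : Type} [Fintype α] [DecidableEq α] [Fintype β] [DecidableEq β]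

lemma eq_of_sameCycle_of_mem_fixSpace {σ : Perm α} {f : α → ℝ} (hf : f ∈ fixSpace σ) {x y : α}
    (h : σ.SameCycle x y) : f x = f y := by
  obtain ⟨i, -, -, rfl⟩ := h.exists_pow_eq
  clear h
  induction i with
  | zero => rfl
  | succ i ih => rw [pow_succ', Perm.mul_apply, hf]; exact ih

/-- The cycle through a point, or the point itself if it is fixed. -/
noncomputable def cycleLabel (σ : Perm α) (x : α) :
    σ.cycleFactorsFinset ⊕ {x : α // x ∈ Finset.univ.filter fun a : α => σ a = a} :=
  if h : σ x = x then .inr ⟨x, by simpa using h⟩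
  else .inl ⟨σ.cycleOf x, Perm.cycleOf_mem_cycleFactorsFinset_iff.2 (by simpa using h)⟩

lemma cycleLabel_surjective (σ : Perm α) : Function.Surjective (cycleLabel σ) := by
  rintro (⟨c, hc⟩ | ⟨x, hx⟩)
  · obtain ⟨x, hx⟩ := (Perm.mem_cycleFactorsFinset_iff.1 hc).1.nonempty_support
    have h : σ x ≠ x := by
      rw [← (Perm.mem_cycleFactorsFinset_iff.1 hc).2 x hx]; simpa using hx
    exact ⟨x, by simp [cycleLabel, h, Perm.cycle_is_cycleOf hx hc]⟩
  · have h : σ x = x := by simpa using hx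
    exact ⟨x, by simp [cycleLabel, h]⟩

lemma sameCycle_of_cycleLabel_eq {σ : Perm α} {x y : α} (h : cycleLabel σ x = cycleLabel σ y) :
    σ.SameCycle x y := by
  unfold cycleLabel at h
  split_ifs at h with hx hy hy
  · simp at h; rw [h]
  · simp only [Sum.inl.injEq, Subtype.mk.injEq] at h
    have : y ∈ (σ.cycleOf x).support := by
      rw [h, Perm.mem_support_cycleOf_iff]; exact ⟨.refl _ _, by simpa using hy⟩
    exact (Perm.mem_support_cycleOf_iff.1 this).1

lemma cycleLabel_apply (σ : Perm α) (x : α) : cycleLabel σ (σ x) = cycleLabel σ x := by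
  unfold cycleLabel
  by_cases h : σ x = x
  · simp [h]
  · have : σ.cycleOf (σ x) = σ.cycleOf x := by
      exact Perm.SameCycle.cycleOf_eq (Perm.sameCycle_apply_left.2 (.refl _ _))
    simp [h, this]

lemma range_funLeft_cycleLabel (σ : Perm α) :
    LinearMap.range (LinearMap.funLeft ℝ ℝ (cycleLabel σ)) = fixSpace σ := by
  ext f
  constructor
  · rintro ⟨g, rfl⟩ x
    simp [LinearMap.funLeft_apply, cycleLabel_apply]
  · intro hf
    refine ⟨fun c => f (Function.surjInv (cycleLabel_surjective σ) c), ?_⟩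
    ext x
    simp only [LinearMap.funLeft_apply]
    exact eq_of_sameCycle_of_mem_fixSpace hf
      (sameCycle_of_cycleLabel_eq (Function.surjInv_eq (cycleLabel_surjective σ) _))

lemma finrank_fixSpace (σ : Perm α) : Module.finrank ℝ (fixSpace σ) = numCycles σ := by
  rw [← range_funLeft_cycleLabel,
    LinearMap.finrank_range_of_inj (LinearMap.funLeft_injective_of_surjective _ _ _
      (cycleLabel_surjective σ))]
  simp [numCycles, Perm.cycleType_def, Fintype.card_subtype]

lemma numCycles_permCongr (e : α ≃ β) (σ : Perm α) :
    numCycles (e.permCongr σ) = numCycles σ := by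
  rw [← finrank_fixSpace, ← finrank_fixSpace]
  refine (LinearEquiv.finrank_eq ((LinearEquiv.funCongrLeft ℝ ℝ e).submoduleMap _)).trans
    (congrArg (fun p : Submodule ℝ (α → ℝ) => Module.finrank ℝ p) ?_)
  ext f
  constructor
  · rintro ⟨g, hg, rfl⟩ x
    have := hg (e x)
    simpa [LinearEquiv.funCongrLeft, LinearMap.funLeft_apply] using this
  · intro hf
    refine ⟨f ∘ e.symm, fun x => ?_, ?_⟩
    · simp [hf _]
    · ext x
      simp [LinearEquiv.funCongrLeft, LinearMap.funLeft_apply]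

lemma numCycles_sumCongr (σ : Perm α) (τ : Perm β) :
    numCycles (Perm.sumCongr σ τ) = numCycles σ + numCycles τ := by
  simp only [← finrank_fixSpace]
  rw [← Module.finrank_prod]
  refine LinearEquiv.finrank_eq
    { toFun := fun f => (⟨fun x => f.1 (.inl x), fun x => by simpa using f.2 (.inl x)⟩,
        ⟨fun x => f.1 (.inr x), fun x => by simpa using f.2 (.inr x)⟩)
      map_add' := fun f g => rfl
      map_smul' := fun c f => rfl
      invFun := fun p => ⟨Sum.elim p.1.1 p.2.1, ?_⟩
      left_inv := fun f => ?_
      right_inv := fun p => rfl }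
  · rintro (x | x)
    · simpa using p.1.2 x
    · simpa using p.2.2 x
  · ext (x | x) <;> rfl

lemma numCycles_optionCongr (σ : Perm α) :
    numCycles (optionCongr σ : Perm (Option α)) = numCycles σ + 1 := by
  simp only [← finrank_fixSpace]
  rw [← Module.finrank_self ℝ, ← Module.finrank_prod]
  refine LinearEquiv.finrank_eq
    { toFun := fun f => (⟨fun x => f.1 (some x), fun x => by simpa using f.2 (some x)⟩, f.1 none)
      map_add' := fun f g => rfl
      map_smul' := fun c f => rfl
      invFun := fun p => ⟨fun x => x.elim p.2 p.1.1, ?_⟩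
      left_inv := fun f => ?_
      right_inv := fun p => rfl }
  · rintro (_ | x)
    · simp
    · simpa using p.1.2 x
  · ext (_ | x) <;> rfl

lemma sign_eq_numCycles (σ : Perm α) :
    Perm.sign σ = (-1) ^ (Fintype.card α + numCycles σ) := by
  have h1 : (Finset.univ.filter fun a : α => σ a = a).card + σ.support.card = Fintype.card α := by
    exact Finset.card_filter_add_card_filter_not (s := Finset.univ) (fun a => σ a = a)
  rw [Perm.sign_of_cycleType, Perm.sum_cycleType, numCycles, ← h1]
  generalize (Finset.univ.filter fun a : α => σ a = a).card = m
  rw [show m + σ.support.card + (σ.cycleType.card + m) =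
    2 * m + (σ.support.card + σ.cycleType.card) by ring, pow_add _ (2 * m), pow_mul]
  simp

lemma numCycles_swap_mul_ne {a b : α} (hab : a ≠ b) (σ : Perm α) :
    numCycles (swap a b * σ) ≠ numCycles σ := by
  intro h
  have h1 := sign_eq_numCycles (swap a b * σ)
  rw [h, ← sign_eq_numCycles, Perm.sign_mul, Perm.sign_swap hab] at h1
  rcases Int.units_eq_one_or (Perm.sign σ) with h2 | h2 <;> simp [h2] at h1

lemma finrank_fixSpace_le_inf_add_one (a b : α) (σ : Perm α) :
    numCycles σ ≤ Module.finrank ℝ ↥(fixSpace σ ⊓ eqSpace a b) + 1 := by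
  have h1 := Submodule.finrank_sup_add_finrank_inf_eq (fixSpace σ) (eqSpace a b)
  have h2 := Submodule.finrank_le (fixSpace σ ⊔ eqSpace a b)
  have h3 := LinearMap.finrank_range_add_finrank_ker
    (LinearMap.proj (R := ℝ) (φ := fun _ : α => ℝ) a - LinearMap.proj b)
  have h4 := Submodule.finrank_le (LinearMap.range
    (LinearMap.proj (R := ℝ) (φ := fun _ : α => ℝ) a - LinearMap.proj b))
  rw [finrank_fixSpace] at h1
  rw [Module.finrank_self] at h4
  unfold eqSpace at *
  omega

lemma numCycles_le_swap_mul_add_one (a b : α) (σ : Perm α) :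
    numCycles σ ≤ numCycles (swap a b * σ) + 1 := by
  have h1 := Submodule.finrank_mono (fixSpace_inf_eqSpace_le a b σ)
  rw [finrank_fixSpace] at h1
  linarith [finrank_fixSpace_le_inf_add_one a b σ]

lemma numCycles_swap_mul {a b : α} (hab : a ≠ b) (σ : Perm α) :
    numCycles (swap a b * σ) = numCycles σ + 1 ∨ numCycles (swap a b * σ) + 1 = numCycles σ := by
  have h1 := numCycles_le_swap_mul_add_one a b σ
  have h2 := numCycles_le_swap_mul_add_one a b (swap a b * σ)
  rw [swap_mul_self_mul] at h2
  have h3 := numCycles_swap_mul_ne hab σ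
  omega

lemma numCycles_swap_mul_of_separated {a b : α} {σ : Perm α} {f : α → ℝ} (hf : f ∈ fixSpace σ)
    (h : f a ≠ f b) : numCycles (swap a b * σ) + 1 = numCycles σ := by
  have hab : a ≠ b := fun e => h (by rw [e])
  refine (numCycles_swap_mul hab σ).resolve_left fun hup => h ?_
  have h1 := finrank_fixSpace_le_inf_add_one a b (swap a b * σ)
  have h2 : fixSpace (swap a b * σ) ⊓ eqSpace a b ≤ fixSpace σ ⊓ eqSpace a b := by
    have := fixSpace_inf_eqSpace_le a b (swap a b * σ)
    rw [swap_mul_self_mul] at this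
    exact le_inf this inf_le_right
  have h3 : fixSpace σ ⊓ eqSpace a b = fixSpace σ :=
    Submodule.eq_of_le_of_finrank_le inf_le_left (by
      rw [finrank_fixSpace]
      have := Submodule.finrank_mono h2
      omega)
  rw [← h3] at hf
  exact mem_eqSpace.1 hf.2

lemma numCycles_swap_apply_mul {a : α} {σ : Perm α} (ha : σ a ≠ a) :
    numCycles (swap a (σ a) * σ) = numCycles σ + 1 := by
  have h1 : fixSpace σ ≤ fixSpace (swap a (σ a) * σ) := fun f hf =>
    fixSpace_inf_eqSpace_le a (σ a) σ ⟨hf, mem_eqSpace.2 (hf a).symm⟩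
  have h2 := Submodule.finrank_mono h1
  rw [finrank_fixSpace, finrank_fixSpace] at h2
  have := numCycles_swap_mul (Ne.symm ha) σ
  omega

lemma numCycles_swap_none_mul_optionCongr (i : α) (σ : Perm α) :
    numCycles (swap none (some i) * optionCongr σ : Perm (Option α)) = numCycles σ := by
  have h := numCycles_swap_mul_of_separated (a := none) (b := some i)
    (σ := (optionCongr σ : Perm (Option α))) (f := fun x => x.elim 1 (fun _ => 0))
    (by rintro (_ | x) <;> simp) (by simp)
  rw [numCycles_optionCongr] at h
  omega

lemma numCycles_inv (σ : Perm α) : numCycles σ⁻¹ = numCycles σ := by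
  have h : fixSpace σ⁻¹ = fixSpace σ := by
    ext f
    constructor
    · intro h x
      simpa using (h (σ x)).symm
    · intro h x
      simpa using (h (σ⁻¹ x)).symm
  rw [← finrank_fixSpace, ← finrank_fixSpace, h]

lemma numCycles_one : numCycles (1 : Perm α) = Fintype.card α := by
  simp [numCycles]

lemma numCycles_le_card (σ : Perm α) : numCycles σ ≤ Fintype.card α := by
  rw [← finrank_fixSpace, ← Module.finrank_fintype_fun_eq_card (R := ℝ)]
  exact Submodule.finrank_le _

lemma numCycles_lt_card {σ : Perm α} (h : σ ≠ 1) : numCycles σ < Fintype.card α := by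
  obtain ⟨a, ha⟩ : ∃ a, σ a ≠ a := by
    by_contra! hc
    exact h (Perm.ext hc)
  have := numCycles_le_card (swap a (σ a) * σ)
  rw [numCycles_swap_apply_mul ha] at this
  omega

end cycles

section weingarten

variable {α β : Type} [Fintype α] [DecidableEq α] [Fintype β] [DecidableEq β]

/-- The Gram matrix of the permutations of a finite type. -/
noncomputable def permGram (α : Type) [Fintype α] [DecidableEq α] (n : ℕ) :
    Matrix (Perm α) (Perm α) ℝ :=
  fun σ τ => (n : ℝ) ^ numCycles (σ * τ⁻¹)

/-- The Weingarten function on the permutations of a finite type. -/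
noncomputable def permWg (n : ℕ) (σ : Perm α) : ℝ :=
  (permGram α n)⁻¹ σ 1

lemma isUnit_permGram {n : ℕ} (hn : Fintype.card (Perm α) ≤ n) : IsUnit (permGram α n) := by
  rw [Matrix.isUnit_iff_isUnit_det, isUnit_iff_ne_zero]
  refine det_ne_zero_of_sum_row_lt_diag fun σ => ?_
  have hcard : 0 < Fintype.card (Perm α) := Fintype.card_pos
  have hn1 : (1 : ℝ) ≤ n := by exact_mod_cast hcard.trans_le hn
  have hdiag : ‖permGram α n σ σ‖ = (n : ℝ) ^ Fintype.card α := by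
    simp [permGram, numCycles_one]
  rw [hdiag]
  rcases Nat.eq_zero_or_pos (Fintype.card α) with h0 | h0
  · have : IsEmpty α := Fintype.card_eq_zero_iff.1 h0
    rw [Finset.sum_eq_zero]
    · positivity
    · intro τ hτ
      exact absurd (Subsingleton.elim τ σ) (Finset.ne_of_mem_erase hτ)
  · calc ∑ τ ∈ Finset.univ.erase σ, ‖permGram α n σ τ‖
        ≤ ∑ τ ∈ Finset.univ.erase σ, (n : ℝ) ^ (Fintype.card α - 1) := by
          refine Finset.sum_le_sum fun τ hτ => ?_
          have hne : σ * τ⁻¹ ≠ 1 := fun h =>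
            Finset.ne_of_mem_erase hτ (mul_inv_eq_one.1 h).symm
          have := numCycles_lt_card hne
          rw [permGram, norm_pow, Real.norm_natCast]
          exact pow_le_pow_right₀ hn1 (by omega)
      _ = ((Fintype.card (Perm α) - 1 : ℕ) : ℝ) * (n : ℝ) ^ (Fintype.card α - 1) := by
          rw [Finset.sum_const, Finset.card_erase_of_mem (Finset.mem_univ _), nsmul_eq_mul,
            Finset.card_univ]
      _ < (n : ℝ) * (n : ℝ) ^ (Fintype.card α - 1) := by
          have : ((Fintype.card (Perm α) - 1 : ℕ) : ℝ) < n := by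
            exact_mod_cast (by omega : Fintype.card (Perm α) - 1 < n)
          gcongr
      _ = (n : ℝ) ^ Fintype.card α := by rw [← pow_succ', Nat.sub_add_cancel h0]

lemma permGram_mulVec (n : ℕ) (g : Perm α → ℝ) (σ : Perm α) :
    (permGram α n).mulVec g σ = ∑ ρ : Perm α, (n : ℝ) ^ numCycles ρ * g (ρ * σ) := by
  rw [Matrix.mulVec, dotProduct, ← Equiv.sum_comp (Equiv.mulRight σ)]
  refine Finset.sum_congr rfl fun ρ _ => ?_
  simp only [permGram, Equiv.coe_mulRight]
  rw [mul_inv_rev, mul_inv_cancel_left, numCycles_inv]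

lemma sum_pow_mul_permWg {n : ℕ} (hn : Fintype.card (Perm α) ≤ n) (σ : Perm α) :
    ∑ ρ : Perm α, (n : ℝ) ^ numCycles ρ * permWg n (ρ * σ) = if σ = 1 then 1 else 0 := by
  rw [← permGram_mulVec]
  have h := Matrix.mul_nonsing_inv (permGram α n)
    ((Matrix.isUnit_iff_isUnit_det _).1 (isUnit_permGram hn))
  have := congrFun (congrFun h σ) 1
  rw [Matrix.one_apply] at this
  exact this

lemma eq_of_sum_pow_mul_eq {n : ℕ} (hn : Fintype.card (Perm α) ≤ n) {g h : Perm α → ℝ}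
    (hgh : ∀ σ, ∑ ρ : Perm α, (n : ℝ) ^ numCycles ρ * g (ρ * σ) =
      ∑ ρ : Perm α, (n : ℝ) ^ numCycles ρ * h (ρ * σ)) : g = h := by
  apply Matrix.mulVec_injective_iff_isUnit.2 (isUnit_permGram hn)
  ext σ
  rw [permGram_mulVec, permGram_mulVec, hgh]

lemma permWg_permCongr (e : α ≃ β) (n : ℕ) (σ : Perm α) :
    permWg n (e.permCongr σ) = permWg n σ := by
  have h : permGram α n = (permGram β n).submatrix e.permCongr e.permCongr := by
    ext σ τ
    simp only [permGram, Matrix.submatrix_apply]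
    rw [← numCycles_permCongr e]
    congr 2
    ext x
    simp [Perm.inv_def, permCongr_def]
  have h1 : e.permCongr (1 : Perm α) = 1 := by ext; simp
  rw [permWg, permWg, h, Matrix.inv_submatrix_equiv, Matrix.submatrix_apply, h1]

lemma card_perm_le_card_perm_option : Fintype.card (Perm α) ≤ Fintype.card (Perm (Option α)) :=
  Fintype.card_le_of_injective _ optionCongr_injective

lemma sum_pow_mul_orthogonality {n : ℕ} (hn : Fintype.card (Perm (Option α)) ≤ n)
    (σ : Perm (Option α)) :
    ∑ ρ : Perm α, (n : ℝ) ^ numCycles ρ * (n * permWg n (optionCongr ρ * σ) +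
      ∑ i : α, permWg n (swap none (some i) * (optionCongr ρ * σ))) =
      if σ = 1 then 1 else 0 := by
  rw [← sum_pow_mul_permWg hn σ, ← Equiv.sum_comp Perm.decomposeOption.symm,
    Fintype.sum_prod_type_right]
  refine Finset.sum_congr rfl fun ρ _ => ?_
  rw [Fintype.sum_option]
  simp only [Perm.decomposeOption_symm_apply, swap_self, numCycles_swap_none_mul_optionCongr]
  rw [← Perm.one_def, one_mul, numCycles_optionCongr, mul_add, Finset.mul_sum, pow_succ]
  simp only [mul_assoc]

lemma permWg_orthogonality {n : ℕ} (hn : Fintype.card (Perm (Option α)) ≤ n) (τ : Perm α) :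
    n * permWg n (optionCongr τ : Perm (Option α)) +
      ∑ i : α, permWg n (swap none (some i) * optionCongr τ) = permWg n τ := by
  refine congrFun (eq_of_sum_pow_mul_eq (card_perm_le_card_perm_option.trans hn)
    (g := fun τ => n * permWg n (optionCongr τ : Perm (Option α)) +
      ∑ i : α, permWg n (swap none (some i) * optionCongr τ)) fun σ => ?_) τ
  have hmul (ρ : Perm α) :
      (optionCongr (ρ * σ) : Perm (Option α)) = optionCongr ρ * optionCongr σ := by
    ext x; cases x <;> simp
  simp only [hmul]
  rw [sum_pow_mul_permWg (card_perm_le_card_perm_option.trans hn),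
    sum_pow_mul_orthogonality hn]
  refine if_congr ?_ rfl rfl
  rw [← optionCongr_one, optionCongr_injective.eq_iff]

lemma permWg_orthogonality_of_none_ne {n : ℕ} (hn : Fintype.card (Perm (Option α)) ≤ n)
    {σ : Perm (Option α)} (hσ : σ none ≠ none) :
    n * permWg n σ + ∑ i : α, permWg n (swap none (some i) * σ) = 0 := by
  have h := congrFun (eq_of_sum_pow_mul_eq (card_perm_le_card_perm_option.trans hn)
    (g := fun ρ => n * permWg n (optionCongr ρ * σ) +
      ∑ i : α, permWg n (swap none (some i) * (optionCongr ρ * σ))) (h := fun _ => 0)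
      fun τ => ?_) 1
  · simpa using h
  have hmul (ρ : Perm α) :
      (optionCongr (ρ * τ) : Perm (Option α)) = optionCongr ρ * optionCongr τ := by
    ext x; cases x <;> simp
  simp only [hmul, mul_assoc]
  rw [sum_pow_mul_orthogonality hn, if_neg]
  · simp
  · intro h
    apply hσ
    have := congrArg (fun π : Perm (Option α) => π none) h
    simpa using this

/-- The Weingarten function rescaled so that it converges to a positive limit. -/
noncomputable def scaledWg (n : ℕ) (σ : Perm α) : ℝ :=
  (-(n : ℝ) ^ 2) ^ Fintype.card α * permWg n σ / (-(n : ℝ)) ^ numCycles σ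

lemma scaledWg_permCongr (e : α ≃ β) (n : ℕ) (σ : Perm α) :
    scaledWg n (e.permCongr σ) = scaledWg n σ := by
  rw [scaledWg, scaledWg, permWg_permCongr, numCycles_permCongr, Fintype.card_congr e]

lemma scaledWg_of_isEmpty [IsEmpty α] {n : ℕ} (hn : 1 ≤ n) (σ : Perm α) : scaledWg n σ = 1 := by
  have h := sum_pow_mul_permWg (α := α) (n := n) (by simpa using hn) 1
  have hc (ρ : Perm α) : numCycles ρ = 0 := by
    have := numCycles_le_card ρ
    simpa using this
  have h1 : permWg n σ = 1 := by
    rw [Subsingleton.elim σ 1]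
    simpa [hc] using h
  simp [scaledWg, hc, h1]

lemma scaledWg_optionCongr {n : ℕ} (hn : Fintype.card (Perm (Option α)) ≤ n) (τ : Perm α) :
    scaledWg n (optionCongr τ : Perm (Option α)) = scaledWg n τ +
      ∑ i : α, scaledWg n (swap none (some i) * optionCongr τ) / (n : ℝ) ^ 2 := by
  have hn0 : (n : ℝ) ≠ 0 := by
    have : 0 < Fintype.card (Perm (Option α)) := Fintype.card_pos
    exact_mod_cast (by omega : n ≠ 0)
  have h := permWg_orthogonality hn τ
  have h' : permWg n (optionCongr τ : Perm (Option α)) = (permWg n τ -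
      ∑ i : α, permWg n (swap none (some i) * optionCongr τ)) / n := by
    field_simp; linarith
  simp only [scaledWg, numCycles_swap_none_mul_optionCongr, numCycles_optionCongr,
    Fintype.card_option, h', ← Finset.mul_sum, ← Finset.sum_div]
  generalize ∑ i : α, permWg n (swap none (some i) * optionCongr τ) = s
  have ht : (-(n : ℝ)) ^ numCycles τ ≠ 0 := pow_ne_zero _ (neg_ne_zero.2 hn0)
  rw [pow_succ _ (Fintype.card α), pow_succ _ (numCycles τ)]
  generalize (-(n : ℝ)) ^ numCycles τ = t at *
  generalize (-(n : ℝ) ^ 2) ^ Fintype.card α = u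
  field_simp
  ring

lemma scaledWg_eq_sum {n : ℕ} (hn : Fintype.card (Perm α) ≤ n) {a : α} {σ : Perm α}
    (ha : σ a ≠ a) :
    scaledWg n σ = ∑ i ∈ Finset.univ.erase a,
      (if numCycles (swap a i * σ) = numCycles σ + 1 then 1 else ((n : ℝ) ^ 2)⁻¹) *
        scaledWg n (swap a i * σ) := by
  have hn0 : (n : ℝ) ≠ 0 := by
    have : 0 < Fintype.card (Perm α) := Fintype.card_pos
    exact_mod_cast (by omega : n ≠ 0)
  have h : n * permWg n σ + ∑ i ∈ Finset.univ.erase a, permWg n (swap a i * σ) = 0 := by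
    have h := permWg_orthogonality_of_none_ne (n := n)
      (σ := (optionSubtypeNe a).symm.permCongr σ)
      (by rwa [← Fintype.card_congr (optionSubtypeNe a).symm.permCongr])
      (by
        intro h
        simp only [permCongr_apply, symm_symm, optionSubtypeNe_none] at h
        rw [Equiv.symm_apply_eq] at h
        exact ha h)
    rw [permWg_permCongr] at h
    rw [← h]
    congr 1
    rw [Finset.sum_subtype (p := fun i => i ≠ a) _ (by simp)]
    refine Finset.sum_congr rfl fun i _ => ?_
    rw [← permWg_permCongr (optionSubtypeNe a).symm]
    congr 1
    have : swap none (some i) = (optionSubtypeNe a).symm.permCongr (swap a i) := by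
      rw [permCongr_def, Equiv.symm_trans_swap_trans, optionSubtypeNe_symm_self,
        optionSubtypeNe_symm_of_ne i.2]
    rw [this]
    ext x
    simp
  have h' : permWg n σ = -(∑ i ∈ Finset.univ.erase a, permWg n (swap a i * σ)) / n := by
    field_simp; linarith
  rw [scaledWg, h', ← Finset.sum_neg_distrib, Finset.sum_div, Finset.mul_sum, Finset.sum_div]
  refine Finset.sum_congr rfl fun i hi => ?_
  rcases numCycles_swap_mul (Finset.ne_of_mem_erase hi).symm σ with h1 | h1
  · have ht : (-(n : ℝ)) ^ numCycles σ ≠ 0 := pow_ne_zero _ (neg_ne_zero.2 hn0)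
    rw [if_pos h1, scaledWg, h1, pow_succ _ (numCycles σ)]
    generalize (-(n : ℝ)) ^ numCycles σ = t at *
    field_simp
  · have ht : (-(n : ℝ)) ^ numCycles (swap a i * σ) ≠ 0 := pow_ne_zero _ (neg_ne_zero.2 hn0)
    rw [if_neg (by omega), scaledWg, ← h1, pow_succ _ (numCycles (swap a i * σ))]
    generalize (-(n : ℝ)) ^ numCycles (swap a i * σ) = t at *
    field_simp

end weingarten

lemma exists_eq_optionCongr {α : Type} [DecidableEq α] {σ : Perm (Option α)} (h : σ none = none) :
    ∃ τ : Perm α, σ = optionCongr τ :=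
  ⟨removeNone σ, by rw [map_equiv_removeNone, h, swap_self, ← Perm.one_def, one_mul]⟩

lemma swap_inr_mul_sumCongr {α β : Type} [DecidableEq α] [DecidableEq β] (σ : Perm α)
    (τ : Perm β) (b i : β) :
    swap (Sum.inr b) (Sum.inr i) * Perm.sumCongr σ τ = Perm.sumCongr σ (swap b i * τ) := by
  rw [← Perm.sumCongr_one_swap, Perm.sumCongr_mul, one_mul]

section asymptotics

open Filter Asymptotics

variable {α β : Type} [Fintype α] [DecidableEq α] [Fintype β] [DecidableEq β]

lemma isBigO_one_of_isBigO_one_add {S : ℕ → ℝ} (hS : ∀ n, 0 ≤ S n)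
    (h : S =O[atTop] fun n : ℕ => 1 + S n * ((n : ℝ) ^ 2)⁻¹) :
    S =O[atTop] fun _ : ℕ => (1 : ℝ) := by
  obtain ⟨C, hC, hb⟩ := h.exists_pos
  refine IsBigO.of_bound (2 * C) ?_
  filter_upwards [hb.bound, eventually_ge_atTop (⌈2 * C⌉₊ + 1)] with n hn hN
  have h1 : 2 * C ≤ n := (Nat.le_ceil _).trans (by exact_mod_cast (by omega))
  have h2 : (1 : ℝ) ≤ n := by exact_mod_cast (by omega : 1 ≤ n)
  have h3 : 2 * C ≤ (n : ℝ) ^ 2 := by nlinarith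
  have h4 : C * ((n : ℝ) ^ 2)⁻¹ ≤ 1 / 2 := by
    rw [← div_eq_mul_inv, div_le_iff₀ (by positivity)]; linarith
  have h5 : 0 ≤ S n * ((n : ℝ) ^ 2)⁻¹ := mul_nonneg (hS n) (by positivity)
  rw [Real.norm_of_nonneg (hS n), Real.norm_of_nonneg (by positivity)] at hn
  rw [Real.norm_of_nonneg (hS n), norm_one]
  nlinarith [mul_le_mul_of_nonneg_left h4 (hS n)]

lemma scaledWg_isBigO_aux {S : ℕ → ℝ} (hS : ∀ n, 0 ≤ S n)
    (hle : ∀ (σ : Perm (Option α)) n, |scaledWg n σ| ≤ S n)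
    (ih : ∀ τ : Perm α, (fun n => scaledWg n τ) =O[atTop] fun _ => (1 : ℝ)) (d : ℕ) :
    ∀ σ : Perm (Option α), Fintype.card (Option α) ≤ numCycles σ + d →
      (fun n => scaledWg n σ) =O[atTop] fun n : ℕ => 1 + S n * ((n : ℝ) ^ 2)⁻¹ := by
  have hpos (n : ℕ) : 0 ≤ S n * ((n : ℝ) ^ 2)⁻¹ := mul_nonneg (hS n) (by positivity)
  have hone : (fun _ : ℕ => (1 : ℝ)) =O[atTop] fun n : ℕ => 1 + S n * ((n : ℝ) ^ 2)⁻¹ :=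
    isBigO_of_le _ fun n => by
      rw [norm_one, Real.norm_of_nonneg (by linarith [hpos n])]
      linarith [hpos n]
  have hsmall (σ : Perm (Option α)) : (fun n : ℕ => ((n : ℝ) ^ 2)⁻¹ * scaledWg n σ) =O[atTop]
      fun n : ℕ => 1 + S n * ((n : ℝ) ^ 2)⁻¹ :=
    isBigO_of_le _ fun n => by
      rw [norm_mul, Real.norm_of_nonneg (by positivity : 0 ≤ ((n : ℝ) ^ 2)⁻¹),
        Real.norm_of_nonneg (by linarith [hpos n] : 0 ≤ 1 + S n * ((n : ℝ) ^ 2)⁻¹),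
        Real.norm_eq_abs]
      have := mul_le_mul_of_nonneg_left (hle σ n) (by positivity : 0 ≤ ((n : ℝ) ^ 2)⁻¹)
      linarith
  induction d with
  | zero =>
    intro σ hσ
    have : σ = 1 := by
      by_contra h
      have := numCycles_lt_card h
      omega
    subst this
    refine IsBigO.congr' (f₁ := fun n : ℕ => scaledWg n (1 : Perm α) +
      ∑ i : α, ((n : ℝ) ^ 2)⁻¹ * scaledWg n (swap none (some i) * optionCongr (1 : Perm α)))
      (((ih 1).trans hone).add (IsBigO.fun_sum fun i _ => hsmall _)) ?_ .rfl
    filter_upwards [eventually_ge_atTop (Fintype.card (Perm (Option α)))] with n hn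
    rw [← optionCongr_one, scaledWg_optionCongr hn]
    simp only [div_eq_inv_mul]
  | succ d ihd =>
    intro σ hσ
    by_cases h : σ none = none
    · obtain ⟨τ, rfl⟩ := exists_eq_optionCongr h
      refine IsBigO.congr' (f₁ := fun n : ℕ => scaledWg n τ +
        ∑ i : α, ((n : ℝ) ^ 2)⁻¹ * scaledWg n (swap none (some i) * optionCongr τ))
        (((ih τ).trans hone).add (IsBigO.fun_sum fun i _ => hsmall _)) ?_ .rfl
      filter_upwards [eventually_ge_atTop (Fintype.card (Perm (Option α)))] with n hn
      rw [scaledWg_optionCongr hn]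
      simp only [div_eq_inv_mul]
    · refine IsBigO.congr' (f₁ := fun n : ℕ => ∑ i ∈ Finset.univ.erase none,
        (if numCycles (swap none i * σ) = numCycles σ + 1 then 1 else ((n : ℝ) ^ 2)⁻¹) *
          scaledWg n (swap none i * σ)) (IsBigO.fun_sum fun i _ => ?_) ?_ .rfl
      · split_ifs with hi
        · simp only [one_mul]
          exact ihd _ (by omega)
        · exact hsmall _
      · filter_upwards [eventually_ge_atTop (Fintype.card (Perm (Option α)))] with n hn
        rw [scaledWg_eq_sum hn h]

lemma scaledWg_isBigO_one (σ : Perm α) : (fun n => scaledWg n σ) =O[atTop] fun _ => (1 : ℝ) := by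
  rename_i i1 i2
  revert σ i2
  refine Fintype.induction_empty_option
    (P := fun α _ => ∀ [DecidableEq α] (σ : Perm α),
      (fun n => scaledWg n σ) =O[atTop] fun _ => (1 : ℝ)) ?_ ?_ ?_ α
  · intro α β _ e h _ σ
    let _ : Fintype α := Fintype.ofEquiv β e.symm
    classical
    have := h (e.symm.permCongr σ)
    simp only [scaledWg_permCongr] at this
    exact this
  · intro _ σ
    refine IsBigO.congr' (isBigO_refl (fun _ => (1 : ℝ)) atTop) ?_ .rfl
    filter_upwards [eventually_ge_atTop 1] with n hn
    rw [scaledWg_of_isEmpty hn]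
  · intro α _ h inst σ
    let _ : DecidableEq α := Classical.decEq α
    obtain rfl : inst = Option.instDecidableEq := Subsingleton.elim _ _
    let S : ℕ → ℝ := fun n => ∑ σ : Perm (Option α), |scaledWg n σ|
    have hS (n : ℕ) : 0 ≤ S n := Finset.sum_nonneg fun _ _ => abs_nonneg _
    have hle (σ : Perm (Option α)) (n : ℕ) : |scaledWg n σ| ≤ S n :=
      Finset.single_le_sum (f := fun σ : Perm (Option α) => |scaledWg n σ|)
        (fun _ _ => abs_nonneg _) (Finset.mem_univ σ)
    have hb (σ : Perm (Option α)) := scaledWg_isBigO_aux hS hle h _ σ (Nat.le_add_left _ _)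
    have hSO : S =O[atTop] fun _ : ℕ => (1 : ℝ) :=
      isBigO_one_of_isBigO_one_add hS (IsBigO.fun_sum fun σ _ => (hb σ).abs_left)
    refine (isBigO_of_le _ fun n => ?_).trans hSO
    rw [Real.norm_of_nonneg (hS n)]
    exact hle σ n

lemma inv_sq_mul_scaledWg_isBigO (σ : Perm α) :
    (fun n : ℕ => ((n : ℝ) ^ 2)⁻¹ * scaledWg n σ) =O[atTop] fun n : ℕ => ((n : ℝ) ^ 2)⁻¹ := by
  simpa using (isBigO_refl (fun n : ℕ => ((n : ℝ) ^ 2)⁻¹) atTop).mul (scaledWg_isBigO_one σ)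

lemma scaledWg_optionCongr_sub_isBigO (τ : Perm α) :
    (fun n => scaledWg n (optionCongr τ : Perm (Option α)) - scaledWg n τ) =O[atTop]
      fun n : ℕ => ((n : ℝ) ^ 2)⁻¹ := by
  refine IsBigO.congr' (f₁ := fun n : ℕ =>
    ∑ i : α, ((n : ℝ) ^ 2)⁻¹ * scaledWg n (swap none (some i) * optionCongr τ))
    (IsBigO.fun_sum fun i _ => inv_sq_mul_scaledWg_isBigO _) ?_ .rfl
  filter_upwards [eventually_ge_atTop (Fintype.card (Perm (Option α)))] with n hn
  rw [scaledWg_optionCongr hn, add_sub_cancel_left]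
  simp only [div_eq_inv_mul]

/-- The points `i` such that multiplication by the transposition `(a i)` splits a cycle. -/
def splittingPoints (a : α) (σ : Perm α) : Finset α :=
  Finset.univ.filter fun i => numCycles (swap a i * σ) = numCycles σ + 1

lemma mem_splittingPoints {a i : α} {σ : Perm α} :
    i ∈ splittingPoints a σ ↔ numCycles (swap a i * σ) = numCycles σ + 1 := by
  simp [splittingPoints]

lemma scaledWg_sub_sum_isBigO {a : α} {σ : Perm α} (ha : σ a ≠ a) :
    (fun n => scaledWg n σ - ∑ i ∈ splittingPoints a σ, scaledWg n (swap a i * σ)) =O[atTop]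
      fun n : ℕ => ((n : ℝ) ^ 2)⁻¹ := by
  have hsub : splittingPoints a σ = (Finset.univ.erase a).filter
      fun i => numCycles (swap a i * σ) = numCycles σ + 1 := by
    ext i
    simp only [mem_splittingPoints, Finset.mem_filter, Finset.mem_erase, Finset.mem_univ, and_true]
    refine ⟨fun h => ⟨?_, h⟩, fun h => h.2⟩
    rintro rfl
    rw [swap_self, ← Perm.one_def, one_mul] at h
    omega
  refine IsBigO.congr' (f₁ := fun n : ℕ => ∑ i ∈ (Finset.univ.erase a).filter
      fun i => ¬ numCycles (swap a i * σ) = numCycles σ + 1,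
      ((n : ℝ) ^ 2)⁻¹ * scaledWg n (swap a i * σ))
    (IsBigO.fun_sum fun i _ => inv_sq_mul_scaledWg_isBigO _) ?_ .rfl
  filter_upwards [eventually_ge_atTop (Fintype.card (Perm α))] with n hn
  rw [scaledWg_eq_sum hn ha, hsub, eq_sub_iff_add_eq, add_comm]
  simp only [ite_mul, one_mul]
  rw [Finset.sum_ite]

/-- A sequence is eventually bounded below by a positive constant. -/
def EventuallyBoundedBelow (f : ℕ → ℝ) : Prop :=
  ∃ c : ℝ, 0 < c ∧ ∀ᶠ n in atTop, c ≤ f n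

lemma EventuallyBoundedBelow.of_sub_isBigO {f g : ℕ → ℝ} (hg : EventuallyBoundedBelow g)
    (h : (fun n => f n - g n) =O[atTop] fun n : ℕ => ((n : ℝ) ^ 2)⁻¹) :
    EventuallyBoundedBelow f := by
  obtain ⟨c, hc, hcg⟩ := hg
  have ht : Tendsto (fun n : ℕ => ((n : ℝ) ^ 2)⁻¹) atTop (nhds 0) :=
    ((tendsto_pow_atTop two_ne_zero).comp tendsto_natCast_atTop_atTop).inv_tendsto_atTop
  refine ⟨c / 2, by positivity, ?_⟩
  filter_upwards [hcg, (h.trans_tendsto ht).eventually (lt_mem_nhds (by linarith : -(c / 2) < 0))]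
    with n h1 h2
  linarith

lemma EventuallyBoundedBelow.sum {ι : Type} {s : Finset ι} (hs : s.Nonempty) {f : ι → ℕ → ℝ}
    (h : ∀ i ∈ s, EventuallyBoundedBelow (f i)) :
    EventuallyBoundedBelow fun n => ∑ i ∈ s, f i n := by
  choose! c hc hcf using h
  refine ⟨∑ i ∈ s, c i, Finset.sum_pos hc hs, ?_⟩
  filter_upwards [(eventually_all_finset s).2 hcf] with n hn
  exact Finset.sum_le_sum hn

lemma scaledWg_eventuallyBoundedBelow_aux
    (ih : ∀ τ : Perm α, EventuallyBoundedBelow fun n => scaledWg n τ) (d : ℕ) :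
    ∀ σ : Perm (Option α), Fintype.card (Option α) ≤ numCycles σ + d →
      EventuallyBoundedBelow fun n => scaledWg n σ := by
  induction d with
  | zero =>
    intro σ hσ
    have : σ = 1 := by
      by_contra h
      have := numCycles_lt_card h
      omega
    subst this
    rw [← optionCongr_one]
    exact (ih 1).of_sub_isBigO (scaledWg_optionCongr_sub_isBigO 1)
  | succ d ihd =>
    intro σ hσ
    by_cases h : σ none = none
    · obtain ⟨τ, rfl⟩ := exists_eq_optionCongr h
      exact (ih τ).of_sub_isBigO (scaledWg_optionCongr_sub_isBigO τ)
    · refine (EventuallyBoundedBelow.sum ⟨σ none, mem_splittingPoints.2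
        (numCycles_swap_apply_mul h)⟩ fun i hi => ?_).of_sub_isBigO (scaledWg_sub_sum_isBigO h)
      have := mem_splittingPoints.1 hi
      exact ihd _ (by omega)

lemma scaledWg_eventuallyBoundedBelow (σ : Perm α) :
    EventuallyBoundedBelow fun n => scaledWg n σ := by
  rename_i i1 i2
  revert σ i2
  refine Fintype.induction_empty_option
    (P := fun α _ => ∀ [DecidableEq α] (σ : Perm α),
      EventuallyBoundedBelow fun n => scaledWg n σ) ?_ ?_ ?_ α
  · intro α β _ e h _ σ
    let _ : Fintype α := Fintype.ofEquiv β e.symm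
    classical
    have := h (e.symm.permCongr σ)
    simp only [scaledWg_permCongr] at this
    exact this
  · intro _ σ
    refine ⟨1, one_pos, ?_⟩
    filter_upwards [eventually_ge_atTop 1] with n hn
    rw [scaledWg_of_isEmpty hn]
  · intro α _ h inst σ
    let _ : DecidableEq α := Classical.decEq α
    obtain rfl : inst = Option.instDecidableEq := Subsingleton.elim _ _
    exact scaledWg_eventuallyBoundedBelow_aux h _ σ (Nat.le_add_left _ _)

lemma scaledWg_sumCongr_optionCongr (σ : Perm α) (τ : Perm β) (n : ℕ) :
    scaledWg n (Perm.sumCongr σ (optionCongr τ : Perm (Option β))) =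
      scaledWg n (optionCongr (Perm.sumCongr σ τ) : Perm (Option (α ⊕ β))) := by
  let e : α ⊕ Option β ≃ Option (α ⊕ β) :=
    { toFun := Sum.elim (fun a => some (.inl a)) (fun b => b.map .inr)
      invFun := fun x => x.elim (.inr none) (Sum.map id some)
      left_inv := by rintro (a | _ | b) <;> rfl
      right_inv := by rintro (_ | a | b) <;> rfl }
  rw [← scaledWg_permCongr e]
  congr 1
  ext x : 1
  rcases x with _ | a | b <;> simp [e]

lemma splittingPoints_sumCongr (σ : Perm α) (τ : Perm β) (b : β) :
    splittingPoints (Sum.inr b) (Perm.sumCongr σ τ) =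
      (splittingPoints b τ).map Function.Embedding.inr := by
  ext (a | i)
  · simp only [mem_splittingPoints, Finset.mem_map, Function.Embedding.inr_apply, reduceCtorEq,
      and_false, exists_false, iff_false]
    have := numCycles_swap_mul_of_separated (σ := Perm.sumCongr σ τ) (a := Sum.inr b)
      (b := Sum.inl a) (f := Sum.elim 0 1) (by rintro (x | x) <;> simp) (by simp)
    omega
  · simp only [mem_splittingPoints, swap_inr_mul_sumCongr, numCycles_sumCongr, Finset.mem_map,
      Function.Embedding.inr_apply, Sum.inr.injEq, exists_eq_right]
    omega

lemma scaledWg_sumCongr_isBigO_of_eq (σ : Perm α) (τ : Perm β)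
    (ih : (fun n => scaledWg n (Perm.sumCongr σ τ) - scaledWg n σ * scaledWg n τ) =O[atTop]
      fun n : ℕ => ((n : ℝ) ^ 2)⁻¹) :
    (fun n => scaledWg n (Perm.sumCongr σ (optionCongr τ : Perm (Option β))) -
      scaledWg n σ * scaledWg n (optionCongr τ : Perm (Option β))) =O[atTop]
        fun n : ℕ => ((n : ℝ) ^ 2)⁻¹ := by
  have h1 := scaledWg_optionCongr_sub_isBigO (Perm.sumCongr σ τ)
  have h2 := (scaledWg_isBigO_one σ).mul (scaledWg_optionCongr_sub_isBigO τ)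
  simp only [one_mul] at h2
  refine ((h1.add ih).sub h2).congr_left fun n => ?_
  rw [scaledWg_sumCongr_optionCongr]
  ring

lemma scaledWg_sumCongr_isBigO_of_ne (σ : Perm α) {τ : Perm β} {b : β} (hb : τ b ≠ b)
    (ih : ∀ i ∈ splittingPoints b τ, (fun n => scaledWg n (Perm.sumCongr σ (swap b i * τ)) -
      scaledWg n σ * scaledWg n (swap b i * τ)) =O[atTop] fun n : ℕ => ((n : ℝ) ^ 2)⁻¹) :
    (fun n => scaledWg n (Perm.sumCongr σ τ) - scaledWg n σ * scaledWg n τ) =O[atTop]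
        fun n : ℕ => ((n : ℝ) ^ 2)⁻¹ := by
  have h1 := scaledWg_sub_sum_isBigO (a := Sum.inr b) (σ := Perm.sumCongr σ τ) (by simpa using hb)
  have h2 := (scaledWg_isBigO_one σ).mul (scaledWg_sub_sum_isBigO hb)
  simp only [one_mul] at h2
  refine ((h1.add (IsBigO.fun_sum ih)).sub h2).congr_left fun n => ?_
  simp only [splittingPoints_sumCongr, Finset.sum_map, Function.Embedding.inr_apply,
    swap_inr_mul_sumCongr, Finset.sum_sub_distrib, ← Finset.mul_sum]
  ring

lemma scaledWg_sumCongr_isBigO_aux (σ : Perm α)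
    (ih : ∀ τ : Perm β, (fun n => scaledWg n (Perm.sumCongr σ τ) - scaledWg n σ * scaledWg n τ)
      =O[atTop] fun n : ℕ => ((n : ℝ) ^ 2)⁻¹) (d : ℕ) :
    ∀ τ : Perm (Option β), Fintype.card (Option β) ≤ numCycles τ + d →
      (fun n => scaledWg n (Perm.sumCongr σ τ) - scaledWg n σ * scaledWg n τ) =O[atTop]
        fun n : ℕ => ((n : ℝ) ^ 2)⁻¹ := by
  induction d with
  | zero =>
    intro τ hτ
    have : τ = 1 := by
      by_contra h
      have := numCycles_lt_card h
      omega
    subst this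
    rw [← optionCongr_one]
    exact scaledWg_sumCongr_isBigO_of_eq σ 1 (ih 1)
  | succ d ihd =>
    intro τ hτ
    by_cases h : τ none = none
    · obtain ⟨τ, rfl⟩ := exists_eq_optionCongr h
      exact scaledWg_sumCongr_isBigO_of_eq σ τ (ih τ)
    · refine scaledWg_sumCongr_isBigO_of_ne σ h fun i hi => ihd _ ?_
      have := mem_splittingPoints.1 hi
      omega

lemma scaledWg_sumCongr_isBigO (σ : Perm α) (τ : Perm β) :
    (fun n => scaledWg n (Perm.sumCongr σ τ) - scaledWg n σ * scaledWg n τ) =O[atTop]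
      fun n : ℕ => ((n : ℝ) ^ 2)⁻¹ := by
  rename_i i1 i2
  revert τ i2
  refine Fintype.induction_empty_option
    (P := fun β _ => ∀ [DecidableEq β] (τ : Perm β),
      (fun n => scaledWg n (Perm.sumCongr σ τ) - scaledWg n σ * scaledWg n τ) =O[atTop]
        fun n : ℕ => ((n : ℝ) ^ 2)⁻¹) ?_ ?_ ?_ β
  · intro β γ _ e h _ τ
    let _ : Fintype β := Fintype.ofEquiv γ e.symm
    classical
    refine (h (e.symm.permCongr τ)).congr_left fun n => ?_
    rw [scaledWg_permCongr, ← scaledWg_permCongr (Equiv.sumCongr (Equiv.refl α) e)]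
    congr 2
    ext (x | x) <;> simp
  · intro _ τ
    refine IsBigO.congr' (isBigO_zero _ atTop) ?_ .rfl
    filter_upwards [eventually_ge_atTop 1] with n hn
    rw [scaledWg_of_isEmpty hn τ, mul_one, ← scaledWg_permCongr (Equiv.sumEmpty α PEmpty), eq_comm,
      sub_eq_zero]
    congr 1
  · intro β _ h inst τ
    let _ : DecidableEq β := Classical.decEq β
    obtain rfl : inst = Option.instDecidableEq := Subsingleton.elim _ _
    exact scaledWg_sumCongr_isBigO_aux σ h _ τ (Nat.le_add_left _ _)

end asymptotics

lemma Wg_eq_permWg (k n : ℕ) (σ : Perm (Fin k)) : Wg k n σ = permWg n σ := rfl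

lemma Wg_disjointSum_div {k₁ k₂ n : ℕ} (σ₁ : Perm (Fin k₁)) (σ₂ : Perm (Fin k₂))
    (hn : (n : ℝ) ≠ 0) :
    Wg (k₁ + k₂) n (disjointSum σ₁ σ₂) / (Wg k₁ n σ₁ * Wg k₂ n σ₂) =
      scaledWg n (Perm.sumCongr σ₁ σ₂) / (scaledWg n σ₁ * scaledWg n σ₂) := by
  rw [Wg_eq_permWg, Wg_eq_permWg, Wg_eq_permWg, disjointSum, permWg_permCongr, scaledWg, scaledWg,
    scaledWg, numCycles_sumCongr, Fintype.card_sum, pow_add, pow_add]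
  have h₁ : (-(n : ℝ)) ^ numCycles σ₁ ≠ 0 := pow_ne_zero _ (neg_ne_zero.2 hn)
  have h₂ : (-(n : ℝ)) ^ numCycles σ₂ ≠ 0 := pow_ne_zero _ (neg_ne_zero.2 hn)
  have h₃ : (-(n : ℝ) ^ 2) ^ Fintype.card (Fin k₁) ≠ 0 :=
    pow_ne_zero _ (neg_ne_zero.2 (pow_ne_zero _ hn))
  have h₄ : (-(n : ℝ) ^ 2) ^ Fintype.card (Fin k₂) ≠ 0 :=
    pow_ne_zero _ (neg_ne_zero.2 (pow_ne_zero _ hn))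
  generalize (-(n : ℝ)) ^ numCycles σ₁ = t₁ at *
  generalize (-(n : ℝ)) ^ numCycles σ₂ = t₂ at *
  generalize (-(n : ℝ) ^ 2) ^ Fintype.card (Fin k₁) = u₁ at *
  generalize (-(n : ℝ) ^ 2) ^ Fintype.card (Fin k₂) = u₂ at *
  field_simp

end helpers

/-- Almost multiplicativity of the unitary Weingarten function:
`Wg(n, σ₁ ⊔ σ₂) = Wg(n,σ₁) Wg(n,σ₂) (1 + O(n^{−2}))`. -/
theorem stmt13 (k₁ k₂ : ℕ) (hk₁ : 1 ≤ k₁) (hk₂ : 1 ≤ k₂)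
    (σ₁ : Equiv.Perm (Fin k₁)) (σ₂ : Equiv.Perm (Fin k₂)) :
    ∃ C : ℝ, 0 < C ∧ ∃ N : ℕ, ∀ n : ℕ, N ≤ n →
      Wg k₁ n σ₁ * Wg k₂ n σ₂ ≠ 0 ∧
      |Wg (k₁ + k₂) n (disjointSum σ₁ σ₂) / (Wg k₁ n σ₁ * Wg k₂ n σ₂) - 1|
        ≤ C / (n : ℝ) ^ 2 := by
  obtain ⟨c₁, hc₁, h₁⟩ := scaledWg_eventuallyBoundedBelow σ₁
  obtain ⟨c₂, hc₂, h₂⟩ := scaledWg_eventuallyBoundedBelow σ₂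
  obtain ⟨K, hK, hb⟩ := (scaledWg_sumCongr_isBigO σ₁ σ₂).exists_pos
  obtain ⟨N, hN⟩ := Filter.eventually_atTop.1
    ((h₁.and h₂).and (hb.bound.and (Filter.eventually_ge_atTop 1)))
  refine ⟨K / (c₁ * c₂), by positivity, N, fun n hn => ?_⟩
  obtain ⟨⟨h1, h2⟩, h3, h4⟩ := hN n hn
  have hn0 : (0 : ℝ) < n := by exact_mod_cast h4
  have hpos₁ : 0 < scaledWg n σ₁ := hc₁.trans_le h1
  have hpos₂ : 0 < scaledWg n σ₂ := hc₂.trans_le h2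
  have hprod : c₁ * c₂ ≤ scaledWg n σ₁ * scaledWg n σ₂ := by gcongr
  have hW : Wg k₁ n σ₁ * Wg k₂ n σ₂ ≠ 0 := by
    refine mul_ne_zero (fun h => hpos₁.ne' ?_) (fun h => hpos₂.ne' ?_)
    · rw [scaledWg, ← Wg_eq_permWg, h, mul_zero, zero_div]
    · rw [scaledWg, ← Wg_eq_permWg, h, mul_zero, zero_div]
  refine ⟨hW, ?_⟩
  rw [Wg_disjointSum_div σ₁ σ₂ hn0.ne', div_sub_one (by positivity), abs_div,
    abs_of_pos (mul_pos hpos₁ hpos₂)]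
  rw [Real.norm_eq_abs, Real.norm_of_nonneg (by positivity)] at h3
  calc _ ≤ K * ((n : ℝ) ^ 2)⁻¹ / (c₁ * c₂) := by gcongr
    _ = K / (c₁ * c₂) / (n : ℝ) ^ 2 := by field_simp
end

section
/- Fix an integer k ≥ 1. For a real number x, let G_k(x) be the square matrix indexed by pairs of permutations σ, τ in S_k with entries G_k(x)_{σ,τ} = x^{#(στ⁻¹)}. Then for every real x > k the matrix G_k(x) is invertible, and for every permutation σ ∈ S_k and every integer m ≥ 0, the m-th derivative of the function x ↦ Wg(x,σ) = (G_k(x)⁻¹)_{σ,e} is a monotone function on the interval (k, ∞) (i.e., for each σ and m it is either nondecreasing throughout (k,∞) or nonincreasing throughout (k,∞)). -/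
/-- The Gram matrix `G_k(x)` indexed by `S_k`, with entries `x^{#(στ⁻¹)}`,
for a real parameter `x`. -/
noncomputable def gramMatrixReal (k : ℕ) (x : ℝ) :
    Matrix (Equiv.Perm (Fin k)) (Equiv.Perm (Fin k)) ℝ :=
  fun σ τ => x ^ cycleCount (σ * τ⁻¹)

/-- The unitary Weingarten function of a real parameter, `Wg(x,σ) = (G_k(x)⁻¹)_{σ,e}`. -/
noncomputable def WgReal (k : ℕ) (x : ℝ) (σ : Equiv.Perm (Fin k)) : ℝ :=
  (gramMatrixReal k x)⁻¹ σ 1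

open Equiv Equiv.Perm

theorem cycleCount_add_sum_cycleType {k : ℕ} (ρ : Perm (Fin k)) :
    cycleCount ρ + ρ.cycleType.sum = ρ.cycleType.card + k := by
  have h : (Finset.univ.filter fun a : Fin k => ρ a = a) = ρ.supportᶜ := by
    ext a
    simp
  have h' := ρ.supportᶜ.card_compl
  have h'' := ρ.supportᶜ.card_le_univ
  rw [compl_compl] at h'
  simp only [Fintype.card_fin] at h' h''
  rw [cycleCount, h, sum_cycleType]
  omega

theorem cycleCount_one (k : ℕ) : cycleCount (1 : Perm (Fin k)) = k := by
  simp [cycleCount]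

/-- Cutting a moved point off its cycle creates one more cycle. -/
theorem cycleCount_swap_mul {k : ℕ} (σ : Perm (Fin k)) (n : Fin k) (h : σ n ≠ n) :
    cycleCount (swap n (σ n) * σ) = cycleCount σ + 1 := by
  obtain ⟨c, r, hc, hd, hcn, rfl⟩ : ∃ c r : Perm (Fin k), c.IsCycle ∧ c.Disjoint r ∧
      c n = σ n ∧ c * r = σ := by
    have hmem := cycleOf_mem_cycleFactorsFinset_iff.mpr (mem_support.mpr h)
    have hd := (disjoint_mul_inv_of_mem_cycleFactorsFinset hmem).symm
    refine ⟨σ.cycleOf n, σ * (σ.cycleOf n)⁻¹, isCycle_cycleOf σ h, hd, cycleOf_apply_self σ n, ?_⟩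
    rw [hd.commute.eq, inv_mul_cancel_right]
  rw [← hcn] at h ⊢
  have hcc := cycleCount_add_sum_cycleType (c * r)
  have hcs := cycleCount_add_sum_cycleType (swap n (c n) * (c * r))
  have hsum := hd.cycleType_mul
  have hc1 := hc.cycleType
  by_cases h2 : c (c n) = n
  · have hsw : c = swap n (c n) := hc.eq_swap_of_apply_apply_eq_self h h2
    have h1 : swap n (c n) * (c * r) = r := by
      rw [← mul_assoc]
      nth_rw 2 [hsw]
      simp
    have hcard : c.support.card = 2 := by
      rw [hsw]
      exact card_support_swap (Ne.symm h)
    rw [h1] at hcs ⊢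
    rw [hsum, hc1, hcard] at hcc
    simp only [Multiset.sum_add, Multiset.card_add, Multiset.sum_singleton,
      Multiset.card_singleton] at hcc
    omega
  · have hs := support_swap_mul_eq c n h2
    have hd' : (swap n (c n) * c).Disjoint r := by
      rw [disjoint_iff_disjoint_support] at hd ⊢
      rw [hs]
      exact hd.mono_left Finset.sdiff_subset
    have hn : n ∈ c.support := mem_support.mpr h
    have hcard : (swap n (c n) * c).support.card + 1 = c.support.card := by
      rw [hs, Finset.sdiff_singleton_eq_erase, Finset.card_erase_add_one hn]
    rw [← mul_assoc] at hcs ⊢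
    rw [hd'.cycleType_mul, (hc.swap_mul h h2).cycleType] at hcs
    rw [hsum, hc1] at hcc
    simp only [Multiset.sum_add, Multiset.card_add, Multiset.sum_singleton,
      Multiset.card_singleton] at hcc hcs
    omega

/-- The signed class function `sgn(ρ) x^{#ρ}`, restricted to the permutations which fix every
point `≥ n`. -/
noncomputable def signedPart (k n : ℕ) (x : ℝ) (ρ : Perm (Fin k)) : ℝ :=
  open Classical in
  if ∀ i : Fin k, n ≤ i → ρ i = i then (sign ρ : ℤ) * x ^ cycleCount ρ else 0

theorem fixes_swap_mul_iff {k : ℕ} (ρ : Perm (Fin k)) {n j : Fin k} (hj : j < n) :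
    (∀ i : Fin k, (n : ℕ) ≤ i → (swap j n * ρ) i = i) ↔
      (∀ i : Fin k, (n : ℕ) + 1 ≤ i → ρ i = i) ∧ ρ n = j := by
  have key (i : Fin k) : (swap j n * ρ) i = i ↔ ρ i = swap j n i := by
    rw [Perm.mul_apply, swap_apply_eq_iff]
  simp only [key]
  constructor
  · intro h
    refine ⟨fun i hi => ?_, by simpa using h n le_rfl⟩
    rw [h i (by omega), swap_apply_of_ne_of_ne] <;> omega
  · rintro ⟨h, hn⟩ i hi
    rcases hi.eq_or_lt with hi | hi
    · obtain rfl : n = i := Fin.ext hi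
      simp [hn]
    · rw [h i hi, swap_apply_of_ne_of_ne] <;> omega

theorem signedPart_succ {k : ℕ} (n : Fin k) (x : ℝ) (ρ : Perm (Fin k)) :
    x * signedPart k (n + 1) x ρ =
      x * signedPart k n x ρ - ∑ j ∈ Finset.Iio n, signedPart k n x (swap j n * ρ) := by
  by_cases hF : ∀ i : Fin k, (n : ℕ) + 1 ≤ i → ρ i = i
  · by_cases hn : ρ n = n
    · have hF' : ∀ i : Fin k, (n : ℕ) ≤ i → ρ i = i := by
        intro i hi
        rcases hi.eq_or_lt with hi | hi
        · obtain rfl : n = i := Fin.ext hi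
          exact hn
        · exact hF i hi
      rw [Finset.sum_eq_zero]
      · rw [signedPart, signedPart, if_pos hF, if_pos hF', sub_zero]
      · intro j hj
        have hj := Finset.mem_Iio.mp hj
        refine if_neg ?_
        rw [fixes_swap_mul_iff ρ hj, hn]
        exact fun h => hj.ne' h.2
    · have hlt : ρ n < n := by
        refine lt_of_le_of_ne (le_of_not_gt fun hlt => hn ?_) hn
        exact ρ.injective (hF _ hlt)
      have h0 : signedPart k n x ρ = 0 := if_neg fun h => hn (h n le_rfl)
      rw [h0, Finset.sum_eq_single_of_mem (ρ n) (Finset.mem_Iio.mpr hlt)]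
      · have h1 : signedPart k n x (swap (ρ n) n * ρ) =
            (sign (swap (ρ n) n * ρ) : ℤ) * x ^ cycleCount (swap (ρ n) n * ρ) :=
          if_pos ((fixes_swap_mul_iff ρ hlt).mpr ⟨hF, rfl⟩)
        have h2 : signedPart k (n + 1) x ρ = (sign ρ : ℤ) * x ^ cycleCount ρ := if_pos hF
        rw [h1, h2, Perm.sign_mul, sign_swap hn, swap_comm, cycleCount_swap_mul ρ n hn]
        push_cast
        ring
      · intro j hj hne
        refine if_neg ?_
        rw [fixes_swap_mul_iff ρ (Finset.mem_Iio.mp hj)]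
        exact fun h => hne h.2.symm
  · have h0 : signedPart k (n + 1) x ρ = 0 := if_neg hF
    have h1 : signedPart k n x ρ = 0 := if_neg fun h => hF fun i hi => h i (by omega)
    rw [h0, h1, Finset.sum_eq_zero]
    · simp
    · intro j hj
      refine if_neg ?_
      rw [fixes_swap_mul_iff ρ (Finset.mem_Iio.mp hj)]
      exact fun h => hF h.1

/-- The matrix of left multiplication by the Jucys–Murphy element `∑_{j < n} (j n)`. -/
noncomputable def jucysMurphy {k : ℕ} (n : Fin k) : Matrix (Perm (Fin k)) (Perm (Fin k)) ℝ :=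
  fun σ τ => ∑ j ∈ Finset.Iio n, if swap j n * σ = τ then 1 else 0

theorem jucysMurphy_nonneg {k : ℕ} (n : Fin k) (σ τ : Perm (Fin k)) : 0 ≤ jucysMurphy n σ τ :=
  Finset.sum_nonneg fun _ _ => by split_ifs <;> norm_num

theorem sum_jucysMurphy_mul {k : ℕ} (n : Fin k) (σ : Perm (Fin k)) (f : Perm (Fin k) → ℝ) :
    ∑ τ, jucysMurphy n σ τ * f τ = ∑ j ∈ Finset.Iio n, f (swap j n * σ) := by
  simp only [jucysMurphy, Finset.sum_mul]
  rw [Finset.sum_comm]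
  simp

open Matrix

theorem signedPart_matrix_succ {k : ℕ} (n : Fin k) (x : ℝ) :
    x • (of fun σ τ : Perm (Fin k) => signedPart k (n + 1) x (σ * τ⁻¹)) =
      (algebraMap ℝ _ x - jucysMurphy n) *
        (of fun σ τ : Perm (Fin k) => signedPart k n x (σ * τ⁻¹)) := by
  ext σ τ
  rw [sub_mul, ← Algebra.smul_def]
  simp only [Matrix.smul_apply, Matrix.sub_apply, Matrix.mul_apply, of_apply, smul_eq_mul, signedPart_succ,
    sum_jucysMurphy_mul, mul_assoc]

/-- A diagonally dominant `Z`-matrix is inverse-nonnegative. -/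
theorem nonneg_of_sub_mulVec_nonneg {ι : Type*} [Fintype ι] [DecidableEq ι] (J : Matrix ι ι ℝ)
    (hJ : ∀ i j, 0 ≤ J i j) {x : ℝ} (hx : ∀ i, ∑ j, J i j < x) (v : ι → ℝ)
    (hv : ∀ i, 0 ≤ ((algebraMap ℝ (Matrix ι ι ℝ) x - J) *ᵥ v) i) (i : ι) : 0 ≤ v i := by
  have : Nonempty ι := ⟨i⟩
  obtain ⟨m, hm⟩ := Finite.exists_min v
  refine le_trans ?_ (hm i)
  have h1 : ((algebraMap ℝ (Matrix ι ι ℝ) x - J) *ᵥ v) m = x * v m - ∑ j, J m j * v j := by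
    rw [Algebra.algebraMap_eq_smul_one, sub_mulVec, smul_mulVec, one_mulVec]
    rfl
  have h2 : (∑ j, J m j) * v m ≤ ∑ j, J m j * v j := by
    rw [Finset.sum_mul]
    exact Finset.sum_le_sum fun j _ => mul_le_mul_of_nonneg_left (hm j) (hJ m j)
  have h3 := hv m
  rw [h1] at h3
  have h4 := hx m
  by_contra! h5
  nlinarith

theorem isUnit_sub_of_sum_lt {ι : Type*} [Fintype ι] [DecidableEq ι] (J : Matrix ι ι ℝ)
    (hJ : ∀ i j, 0 ≤ J i j) {x : ℝ} (hx : ∀ i, ∑ j, J i j < x) :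
    IsUnit (algebraMap ℝ (Matrix ι ι ℝ) x - J) := by
  rw [← mulVec_injective_iff_isUnit, ← coe_mulVecLin, ← LinearMap.ker_eq_bot,
    LinearMap.ker_eq_bot']
  intro v hv
  rw [mulVecLin_apply] at hv
  funext i
  refine le_antisymm ?_ (nonneg_of_sub_mulVec_nonneg J hJ hx v (by simp [hv]) i)
  have := nonneg_of_sub_mulVec_nonneg J hJ hx (-v) (by simp [mulVec_neg, hv]) i
  simpa using this

theorem resolvent_apply_nonneg {ι : Type*} [Fintype ι] [DecidableEq ι] (J : Matrix ι ι ℝ)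
    (hJ : ∀ i j, 0 ≤ J i j) {x : ℝ} (hx : ∀ i, ∑ j, J i j < x) (i j : ι) :
    0 ≤ resolvent J x i j := by
  refine nonneg_of_sub_mulVec_nonneg J hJ hx (fun i => resolvent J x i j) (fun l => ?_) i
  have h : (algebraMap ℝ (Matrix ι ι ℝ) x - J) * resolvent J x = 1 :=
    Ring.mul_inverse_cancel _ (isUnit_sub_of_sum_lt J hJ hx)
  have h' := congrFun (congrFun h l) j
  rw [Matrix.mul_apply] at h'
  change 0 ≤ ∑ m, _ * _
  rw [h', Matrix.one_apply]
  split_ifs <;> norm_num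

section

attribute [local instance] Matrix.linftyOpNormedRing Matrix.linftyOpNormedAlgebra

theorem hasDerivAt_resolvent_apply {ι : Type*} [Fintype ι] [DecidableEq ι] (J : Matrix ι ι ℝ)
    {x : ℝ} (hx : IsUnit (algebraMap ℝ (Matrix ι ι ℝ) x - J)) (i j : ι) :
    HasDerivAt (fun y => resolvent J y i j)
      (-∑ l, resolvent J x i l * resolvent J x l j) x := by
  have : CompleteSpace (Matrix ι ι ℝ) := FiniteDimensional.complete ℝ _
  have h : HasDerivAt (resolvent J) (-resolvent J x ^ 2) x :=
    spectrum.hasDerivAt_resolvent_const_left hx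
  have h' := (LinearMap.toContinuousLinearMap (entryLinearMap ℝ ℝ i j)).hasFDerivAt.comp_hasDerivAt
    x h
  refine h'.congr_deriv ?_
  change (-resolvent J x ^ 2) i j = _
  rw [sq, Matrix.neg_apply, Matrix.mul_apply]

end

theorem sum_jucysMurphy_lt {k : ℕ} (n : Fin k) {x : ℝ} (hx : (k : ℝ) < x) (σ : Perm (Fin k)) :
    ∑ τ, jucysMurphy n σ τ < x := by
  have h := sum_jucysMurphy_mul n σ fun _ => 1
  simp only [mul_one, Finset.sum_const, Fin.card_Iio, nsmul_eq_mul] at h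
  rw [h]
  exact lt_trans (by exact_mod_cast n.2) hx

/-- The semiring of functions generated by the entries of the resolvents of the Jucys–Murphy
matrices. -/
noncomputable def resolventSemiring (k : ℕ) : Subsemiring (ℝ → ℝ) :=
  Subsemiring.closure
    {f | ∃ (n : Fin k) (σ τ : Perm (Fin k)), f = fun x => resolvent (jucysMurphy n) x σ τ}

theorem resolvent_mem {k : ℕ} (n : Fin k) (σ τ : Perm (Fin k)) :
    (fun x => resolvent (jucysMurphy n) x σ τ) ∈ resolventSemiring k :=
  Subsemiring.subset_closure ⟨n, σ, τ, rfl⟩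

theorem nonneg_of_mem {k : ℕ} {f : ℝ → ℝ} (hf : f ∈ resolventSemiring k) {x : ℝ}
    (hx : (k : ℝ) < x) : 0 ≤ f x := by
  induction hf using Subsemiring.closure_induction with
  | mem f hf =>
    obtain ⟨n, σ, τ, rfl⟩ := hf
    exact resolvent_apply_nonneg _ (jucysMurphy_nonneg n) (sum_jucysMurphy_lt n hx) σ τ
  | zero => exact le_rfl
  | one => exact zero_le_one
  | add f g _ _ hf hg => exact add_nonneg hf hg
  | mul f g _ _ hf hg => exact mul_nonneg hf hg

theorem exists_hasDerivAt_neg {k : ℕ} {f : ℝ → ℝ} (hf : f ∈ resolventSemiring k) :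
    ∃ g ∈ resolventSemiring k, ∀ x : ℝ, (k : ℝ) < x → HasDerivAt f (-g x) x := by
  induction hf using Subsemiring.closure_induction with
  | mem f hf =>
    obtain ⟨n, σ, τ, rfl⟩ := hf
    refine ⟨∑ l, (fun x => resolvent (jucysMurphy n) x σ l) *
      (fun x => resolvent (jucysMurphy n) x l τ),
      sum_mem fun l _ => mul_mem (resolvent_mem n σ l) (resolvent_mem n l τ), fun x hx => ?_⟩
    simpa using hasDerivAt_resolvent_apply (jucysMurphy n)
      (isUnit_sub_of_sum_lt _ (jucysMurphy_nonneg n) (sum_jucysMurphy_lt n hx)) σ τ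
  | zero => exact ⟨0, zero_mem _, fun x _ => by simp⟩
  | one => exact ⟨0, zero_mem _, fun x _ => by
    rw [Pi.zero_apply, neg_zero]
    exact hasDerivAt_const x (1 : ℝ)⟩
  | add f g hf hg ihf ihg =>
    obtain ⟨f', hf', hdf⟩ := ihf
    obtain ⟨g', hg', hdg⟩ := ihg
    refine ⟨f' + g', add_mem hf' hg', fun x hx => ?_⟩
    exact ((hdf x hx).add (hdg x hx)).congr_deriv (neg_add _ _).symm
  | mul f g hf hg ihf ihg =>
    obtain ⟨f', hf', hdf⟩ := ihf
    obtain ⟨g', hg', hdg⟩ := ihg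
    refine ⟨f' * g + f * g', add_mem (mul_mem hf' hg) (mul_mem hf hg'), fun x hx => ?_⟩
    refine ((hdf x hx).mul (hdg x hx)).congr_deriv ?_
    rw [Pi.add_apply, Pi.mul_apply, Pi.mul_apply]
    ring

theorem antitoneOn_of_mem {k : ℕ} {f : ℝ → ℝ} (hf : f ∈ resolventSemiring k) :
    AntitoneOn f (Set.Ioi (k : ℝ)) := by
  obtain ⟨g, hg, hd⟩ := exists_hasDerivAt_neg hf
  refine antitoneOn_of_deriv_nonpos (convex_Ioi _)
    (fun x hx => (hd x hx).continuousAt.continuousWithinAt) ?_ ?_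
  · rw [interior_Ioi]
    exact fun x hx => (hd x hx).differentiableAt.differentiableWithinAt
  · rw [interior_Ioi]
    intro x hx
    rw [(hd x hx).deriv]
    exact neg_nonpos.mpr (nonneg_of_mem hg hx)

/-- If `F` agrees with `c • f` on `(k, ∞)`, where `f` is in the resolvent semiring, then its
iterated derivatives agree up to sign with `c • g`, `g` in the resolvent semiring. -/
theorem exists_iteratedDeriv_eq {k : ℕ} {f F : ℝ → ℝ} (hf : f ∈ resolventSemiring k) (c : ℝ)
    (hF : ∀ x : ℝ, (k : ℝ) < x → F x = c * f x) (m : ℕ) :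
    ∃ g ∈ resolventSemiring k, ∀ x : ℝ, (k : ℝ) < x →
      iteratedDeriv m F x = (-1) ^ m * c * g x := by
  induction m with
  | zero => exact ⟨f, hf, fun x hx => by simp [hF x hx]⟩
  | succ m ih =>
    obtain ⟨g, hg, h⟩ := ih
    obtain ⟨g', hg', hd⟩ := exists_hasDerivAt_neg hg
    refine ⟨g', hg', fun x hx => ?_⟩
    have he : iteratedDeriv m F =ᶠ[nhds x] fun y => (-1) ^ m * c * g y := by
      filter_upwards [Ioi_mem_nhds hx] with y hy using h y hy
    rw [iteratedDeriv_succ, he.deriv_eq, ((hd x hx).const_mul _).deriv]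
    ring

theorem exists_mul_signedPart {k : ℕ} (n : ℕ) (hn : n ≤ k) :
    ∃ Q : ℝ → Matrix (Perm (Fin k)) (Perm (Fin k)) ℝ,
      (∀ σ τ, (fun x => Q x σ τ) ∈ resolventSemiring k) ∧ ∀ x : ℝ, (k : ℝ) < x →
        x ^ n • (Q x * of fun σ τ : Perm (Fin k) => signedPart k n x (σ * τ⁻¹)) =
          x ^ k • (1 : Matrix (Perm (Fin k)) (Perm (Fin k)) ℝ) := by
  induction n with
  | zero =>
    refine ⟨fun _ => 1, fun σ τ => ?_, fun x _ => ?_⟩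
    · by_cases h : σ = τ
      · simp only [Matrix.one_apply, if_pos h]
        exact one_mem (resolventSemiring k)
      · simp only [Matrix.one_apply, if_neg h]
        exact zero_mem (resolventSemiring k)
    · ext σ τ
      rw [pow_zero, one_smul, one_mul, of_apply, Matrix.smul_apply, Matrix.one_apply]
      by_cases h : σ = τ
      · simp [h, signedPart, cycleCount_one]
      · have : ¬ ∀ i : Fin k, (σ * τ⁻¹) i = i := fun h' => h (mul_inv_eq_one.mp (Equiv.ext h'))
        simp only [signedPart, Nat.zero_le, true_imp_iff, if_neg this, if_neg h, smul_zero]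
  | succ n ih =>
    obtain ⟨Q, hQ, h⟩ := ih (by omega)
    let N : Fin k := ⟨n, hn⟩
    refine ⟨fun x => Q x * resolvent (jucysMurphy N) x, fun σ τ => ?_, fun x hx => ?_⟩
    · have : (fun x => (Q x * resolvent (jucysMurphy N) x) σ τ) =
          ∑ l, (fun x => Q x σ l) * fun x => resolvent (jucysMurphy N) x l τ := by
        funext x
        simp [Matrix.mul_apply]
      rw [this]
      exact sum_mem fun l _ => mul_mem (hQ σ l) (resolvent_mem N l τ)
    · have hu : resolvent (jucysMurphy N) x * (algebraMap ℝ _ x - jucysMurphy N) = 1 :=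
        Ring.inverse_mul_cancel _
          (isUnit_sub_of_sum_lt _ (jucysMurphy_nonneg N) (sum_jucysMurphy_lt N hx))
      have hs := signedPart_matrix_succ N x
      rw [pow_succ, mul_smul, ← mul_smul_comm]
      change x ^ n • (_ * (x • of fun σ τ : Perm (Fin k) => signedPart k ((N : ℕ) + 1) x _)) = _
      rw [hs, mul_assoc, ← mul_assoc (resolvent _ _), hu, one_mul]
      exact h x hx

/-- For `x > k` the matrix obtained from the Gram matrix by inserting signs has an inverse with
entries in the resolvent semiring. -/
theorem exists_gramMatrixReal_inverse (k : ℕ) :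
    ∃ Q : ℝ → Matrix (Perm (Fin k)) (Perm (Fin k)) ℝ,
      (∀ σ τ, (fun x => Q x σ τ) ∈ resolventSemiring k) ∧ ∀ x : ℝ, (k : ℝ) < x →
        (of fun σ τ => ((sign σ : ℤ) : ℝ) * (sign τ : ℤ) * Q x σ τ) * gramMatrixReal k x = 1 := by
  obtain ⟨Q, hQ, h⟩ := exists_mul_signedPart (k := k) k le_rfl
  refine ⟨Q, hQ, fun x hx => ?_⟩
  have hx0 : x ^ k ≠ 0 := pow_ne_zero _ ((Nat.cast_nonneg k).trans_lt hx).ne'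
  have h1 := smul_right_injective _ hx0 (h x hx)
  have hsq (σ : Perm (Fin k)) : ((sign σ : ℤ) : ℝ) * (sign σ : ℤ) = 1 := by
    rcases Int.units_eq_one_or (sign σ) with h | h <;> simp [h]
  have hpart (ρ : Perm (Fin k)) : signedPart k k x ρ = (sign ρ : ℤ) * x ^ cycleCount ρ :=
    if_pos fun i hi => absurd i.2 (by omega)
  ext σ τ
  have h2 := congrFun (congrFun h1 σ) τ
  simp only [Matrix.mul_apply, of_apply, hpart, Perm.sign_mul, sign_inv] at h2 ⊢
  have h3 : ∑ l, ((sign σ : ℤ) : ℝ) * (sign l : ℤ) * Q x σ l * gramMatrixReal k x l τ =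
      ((sign σ : ℤ) : ℝ) * (sign τ : ℤ) * ∑ l, Q x σ l *
        (((sign l * sign τ : ℤˣ) : ℤ) * x ^ cycleCount (l * τ⁻¹)) := by
    rw [Finset.mul_sum]
    refine Finset.sum_congr rfl fun l _ => ?_
    rw [gramMatrixReal]
    push_cast
    linear_combination (-((sign σ : ℤ) : ℝ) * (sign l : ℤ) * Q x σ l *
      x ^ cycleCount (l * τ⁻¹)) * hsq τ
  rw [h3, h2, Matrix.one_apply]
  split_ifs with hστ
  · rw [hστ, hsq, mul_one]
  · rw [mul_zero]

/-- For `x > k` the matrix `G_k(x)` is invertible, and every unitary Weingarten function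
`x ↦ Wg(x,σ)` together with all its derivatives is monotone on `(k, ∞)`. -/
theorem stmt14 (k : ℕ) (hk : 1 ≤ k) :
    (∀ x : ℝ, (k : ℝ) < x → IsUnit (gramMatrixReal k x).det) ∧
    ∀ σ : Equiv.Perm (Fin k), ∀ m : ℕ,
      MonotoneOn (iteratedDeriv m fun x : ℝ => WgReal k x σ) (Set.Ioi (k : ℝ)) ∨
      AntitoneOn (iteratedDeriv m fun x : ℝ => WgReal k x σ) (Set.Ioi (k : ℝ)) := by
  obtain ⟨Q, hQ, h⟩ := exists_gramMatrixReal_inverse k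
  refine ⟨fun x hx => isUnit_det_of_left_inverse (h x hx), fun σ m => ?_⟩
  have hW (x : ℝ) (hx : (k : ℝ) < x) : WgReal k x σ = (sign σ : ℤ) * Q x σ 1 := by
    rw [WgReal, inv_eq_left_inv (h x hx)]
    simp
  obtain ⟨g, hg, hd⟩ := exists_iteratedDeriv_eq (hQ σ 1) _ hW m
  have hanti := antitoneOn_of_mem hg
  have hc : ((-1 : ℝ) ^ m * (sign σ : ℤ)) = 1 ∨ ((-1 : ℝ) ^ m * (sign σ : ℤ)) = -1 := by
    rcases neg_one_pow_eq_or ℝ m with h | h <;>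
      rcases Int.units_eq_one_or (sign σ) with h' | h' <;> simp [h, h']
  rcases hc with hc | hc <;> simp only [hc] at hd
  · refine Or.inr (hanti.congr fun x hx => ?_)
    rw [hd x hx, one_mul]
  · refine Or.inl (hanti.neg.congr fun x hx => ?_)
    rw [hd x hx, neg_one_mul]
end

section
/- Fix integers k ≥ 1 and n ≥ k, and let σ be a permutation of {1,…,k}. Then the unitary Weingarten function satisfies the lower bound 1/(1 − (k−1)/n²) ≤ n^{k+|σ|} Wg(n,σ) / Moeb(σ). If moreover n > √6 · k^{7/4}, then also the upper bound n^{k+|σ|} Wg(n,σ) / Moeb(σ) ≤ 1/(1 − 6 k^{7/2}/n²) holds. In particular, for n > √6 · k^{7/4}, Wg(n,σ) is nonzero and has the same sign as Moeb(σ). -/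
namespace WeingartenBound

open Equiv Equiv.Perm Finset

variable {α : Type*} [DecidableEq α] [Fintype α]

/-- The cycle type of a single cycle on `p` points: empty when `p ≤ 1`. -/
def singleCycleType (p : ℕ) : Multiset ℕ := if p ≤ 1 then 0 else {p}

/-- The minimal number of transpositions whose product is `σ`. -/
def absLength (σ : Perm α) : ℕ := (σ.cycleType.map fun c => c - 1).sum

/-- The product of the Catalan numbers `Cat_{c-1}` over the cycle lengths `c` of `σ`. -/
def catalanProd (σ : Perm α) : ℕ := (σ.cycleType.map fun c => catalan (c - 1)).prod

theorem cycleType_formPerm_of_nodup {l : List α} (hl : l.Nodup) :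
    (l.formPerm).cycleType = singleCycleType l.length := by
  unfold singleCycleType
  split_ifs with h
  · rw [cycleType_eq_zero, List.formPerm_eq_one_iff _ hl]
    exact h
  · rw [(List.isCycle_formPerm hl (by omega)).cycleType,
      List.support_formPerm_of_nodup _ hl (by rintro x rfl; simp at h),
      List.toFinset_card_of_nodup hl]

omit [Fintype α] in
theorem formPerm_append_eq_swap_mul (l₁ l₂ : List α) (x i : α)
    (h : (x :: l₁ ++ i :: l₂).Nodup) :
    (x :: l₁ ++ i :: l₂).formPerm =
      swap x i * ((x :: l₁).formPerm * (i :: l₂).formPerm) := by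
  induction l₁ generalizing x with
  | nil => simp
  | cons y t ih =>
    have hy := ih y (by simpa using (List.nodup_cons.1 h).2)
    have hxy : x ≠ y := by rintro rfl; simp at h
    have hxi : x ≠ i := by rintro rfl; simp at h
    have hyi : y ≠ i := by rintro rfl; simp at h
    simp only [List.cons_append] at hy ⊢
    rw [List.formPerm_cons_cons, hy, List.formPerm_cons_cons x y t]
    have hswap : swap x y * swap y i = swap x i * swap x y := by
      ext z
      simp only [Perm.mul_apply, swap_apply_def]
      split_ifs <;> simp_all
    rw [← mul_assoc, hswap]
    simp only [mul_assoc]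

theorem exists_cycleType_swap_mul (σ : Perm α) (x : α) (hx : σ x ≠ x) :
    ∃ T : Multiset ℕ, σ.cycleType = #(σ.cycleOf x).support ::ₘ T ∧
      ∀ p, 0 < p → p < #(σ.cycleOf x).support →
        (swap x ((σ ^ p) x) * σ).cycleType =
          singleCycleType p + singleCycleType (#(σ.cycleOf x).support - p) + T := by
  set κ := σ.cycleOf x with hκ
  set ρ := σ * κ⁻¹ with hρ
  have hmem : κ ∈ σ.cycleFactorsFinset :=
    cycleOf_mem_cycleFactorsFinset_iff.2 (mem_support.2 hx)
  have hdis : Disjoint ρ κ := disjoint_mul_inv_of_mem_cycleFactorsFinset hmem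
  have hσ : σ = κ * ρ := by rw [← hdis.commute.eq, hρ]; simp
  have hcyc : κ.IsCycle := isCycle_cycleOf σ hx
  refine ⟨ρ.cycleType, ?_, ?_⟩
  · conv_lhs => rw [hσ]
    rw [hdis.symm.cycleType_mul, hcyc.cycleType]; rfl
  · intro p hp0 hpc
    set L := σ.toList x with hL
    have hnd : L.Nodup := nodup_toList σ x
    have hlen : L.length = #κ.support := length_toList σ x
    have hform : L.formPerm = κ := formPerm_toList σ x
    have hfix : ∀ y ∈ L, ρ y = y := by
      intro y hy
      refine (hdis y).resolve_right ?_
      have hy' := (mem_toList_iff.1 hy).1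
      rw [hκ, hy'.cycleOf_eq]
      have : σ y ≠ y := mem_support.1 (hy'.mem_support_iff.1 (mem_support.2 hx))
      simpa using this
    have hA : L.take p = x :: (L.take p).tail := by
      have h0 : 0 < (L.take p).length := by simp; omega
      rw [← List.cons_head_tail (List.ne_nil_of_length_pos h0)]
      simp only [List.tail_cons, List.cons.injEq, and_true]
      rw [List.head_eq_getElem, List.getElem_take]
      exact toList_getElem_zero σ x (mem_support.2 hx)
    have hB : L.drop p = (σ ^ p) x :: L.drop (p + 1) := by
      rw [List.drop_eq_getElem_cons (by omega)]
      congr 1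
      exact getElem_toList σ x p _
    have hAB : L = L.take p ++ L.drop p := (List.take_append_drop p L).symm
    have hsplit : L.formPerm =
        swap x ((σ ^ p) x) * ((L.take p).formPerm * (L.drop p).formPerm) := by
      have := formPerm_append_eq_swap_mul (L.take p).tail (L.drop (p + 1)) x ((σ ^ p) x)
        (by rw [← hA, ← hB, ← hAB]; exact hnd)
      rwa [← hA, ← hB, ← hAB] at this
    have hprod : swap x ((σ ^ p) x) * σ =
        ((L.take p).formPerm * (L.drop p).formPerm) * ρ := by
      rw [congrArg (swap x ((σ ^ p) x) * ·) hσ, ← hform, hsplit]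
      simp [← mul_assoc]
    have hnd' : (L.take p ++ L.drop p).Nodup := hAB ▸ hnd
    have d1 : Disjoint (L.take p).formPerm (L.drop p).formPerm := by
      intro y
      by_cases hy : y ∈ L.take p
      · right
        exact List.formPerm_apply_of_notMem fun h =>
          (List.disjoint_of_nodup_append hnd') hy h
      · exact Or.inl (List.formPerm_apply_of_notMem hy)
    have d2 : Disjoint (L.take p).formPerm ρ := fun y => by
      by_cases hy : y ∈ L.take p
      · exact Or.inr (hfix y (List.mem_of_mem_take hy))
      · exact Or.inl (List.formPerm_apply_of_notMem hy)
    have d3 : Disjoint (L.drop p).formPerm ρ := fun y => by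
      by_cases hy : y ∈ L.drop p
      · exact Or.inr (hfix y (List.mem_of_mem_drop hy))
      · exact Or.inl (List.formPerm_apply_of_notMem hy)
    rw [hprod, (d2.mul_left d3).cycleType_mul, d1.cycleType_mul,
      cycleType_formPerm_of_nodup (hnd.sublist (List.take_sublist _ _)),
      cycleType_formPerm_of_nodup (hnd.sublist (List.drop_sublist _ _)),
      List.length_take, List.length_drop, hlen, min_eq_left hpc.le]

omit [DecidableEq α] [Fintype α] in
theorem apply_ne_of_sameCycle {σ : Perm α} {x i : α} (h : σ.SameCycle x i) (hi : i ≠ x) :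
    σ x ≠ x := fun hx => hi (h.eq_of_left hx).symm

theorem exists_pow_eq_of_sameCycle {σ : Perm α} {x i : α} (h : σ.SameCycle x i) (hi : i ≠ x) :
    ∃ p, 0 < p ∧ p < #(σ.cycleOf x).support ∧ (σ ^ p) x = i := by
  obtain ⟨p, hp, rfl⟩ := h.exists_pow_eq_of_mem_support (mem_support.2 (apply_ne_of_sameCycle h hi))
  refine ⟨p, Nat.pos_of_ne_zero ?_, hp, rfl⟩
  rintro rfl
  simp at hi

@[simp] theorem sum_singleCycleType (p : ℕ) :
    ((singleCycleType p).map fun c => c - 1).sum = p - 1 := by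
  unfold singleCycleType; split_ifs <;> simp; omega

@[simp] theorem prod_singleCycleType (p : ℕ) :
    ((singleCycleType p).map fun c => catalan (c - 1)).prod = catalan (p - 1) := by
  unfold singleCycleType; split_ifs with h
  · interval_cases p <;> simp
  · simp

theorem absLength_swap_mul_of_sameCycle {σ : Perm α} {x i : α} (h : σ.SameCycle x i)
    (hi : i ≠ x) : absLength (swap x i * σ) + 1 = absLength σ := by
  obtain ⟨T, hT, hp⟩ := exists_cycleType_swap_mul σ x (apply_ne_of_sameCycle h hi)
  obtain ⟨p, hp0, hpc, rfl⟩ := exists_pow_eq_of_sameCycle h hi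
  simp only [absLength, hT, hp p hp0 hpc, Multiset.map_add, Multiset.sum_add,
    sum_singleCycleType, Multiset.map_cons, Multiset.sum_cons]
  omega

theorem exists_catalanProd_swap_mul {σ : Perm α} {x i : α} (h : σ.SameCycle x i)
    (hi : i ≠ x) : ∃ a b m, a + b + 2 ≤ Fintype.card α ∧
      catalanProd σ = catalan (a + b + 1) * m ∧
      catalanProd (swap x i * σ) = catalan a * catalan b * m := by
  obtain ⟨T, hT, hp⟩ := exists_cycleType_swap_mul σ x (apply_ne_of_sameCycle h hi)
  obtain ⟨p, hp0, hpc, rfl⟩ := exists_pow_eq_of_sameCycle h hi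
  have hle : #(σ.cycleOf x).support ≤ Fintype.card α := card_le_univ _
  refine ⟨p - 1, #(σ.cycleOf x).support - p - 1, (T.map fun c => catalan (c - 1)).prod,
    by omega, ?_, ?_⟩
  · simp only [catalanProd, hT, Multiset.map_cons, Multiset.prod_cons]
    congr 2; omega
  · simp only [catalanProd, hp p hp0 hpc, Multiset.map_add, Multiset.prod_add,
      prod_singleCycleType]

theorem sum_catalanProd_swap_mul (σ : Perm α) (x : α) (hx : σ x ≠ x) :
    ∑ i with σ.SameCycle x i ∧ i ≠ x, catalanProd (swap x i * σ) = catalanProd σ := by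
  obtain ⟨T, hT, hp⟩ := exists_cycleType_swap_mul σ x hx
  set c := #(σ.cycleOf x).support with hc
  have hc2 : 2 ≤ c := (isCycle_cycleOf σ hx).two_le_card_support
  have hinj : ∀ p < c, ∀ q < c, (σ ^ p) x = (σ ^ q) x → p = q := by
    intro p hp q hq h
    have hl : (σ.toList x).length = c := length_toList σ x
    rw [← getElem_toList σ x p (by omega), ← getElem_toList σ x q (by omega)] at h
    exact (nodup_toList σ x).getElem_inj_iff.1 h
  have h1 : ∑ p ∈ Finset.range (c - 1), catalanProd (swap x ((σ ^ (p + 1)) x) * σ) =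
      ∑ i with σ.SameCycle x i ∧ i ≠ x, catalanProd (swap x i * σ) := by
    refine Finset.sum_nbij (fun p => (σ ^ (p + 1)) x) ?_ ?_ ?_ ?_
    · intro p hp
      have hp' := Finset.mem_range.1 hp
      simp only [mem_filter, mem_univ, true_and]
      refine ⟨⟨(p + 1 : ℕ), by rw [zpow_natCast]⟩, fun h => ?_⟩
      have := hinj (p + 1) (by omega) 0 (by omega) (by simpa using h)
      omega
    · intro p hp q hq h
      have hp' := Finset.mem_range.1 (Finset.mem_coe.1 hp)
      have hq' := Finset.mem_range.1 (Finset.mem_coe.1 hq)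
      have := hinj (p + 1) (by omega) (q + 1) (by omega) h
      omega
    · intro i hi
      simp only [coe_filter, mem_univ, true_and, Set.mem_ofPred_eq] at hi
      obtain ⟨p, hp0, hpc, rfl⟩ := exists_pow_eq_of_sameCycle hi.1 hi.2
      refine ⟨p - 1, by simp only [coe_range, Set.mem_Iio]; omega, ?_⟩
      simp only [Nat.sub_add_cancel hp0]
    · intro p hp
      rfl
  rw [← h1]
  obtain ⟨d, hd⟩ : ∃ d, c = d + 2 := ⟨c - 2, by omega⟩
  have h2 : catalanProd σ =
      (∑ p ∈ Finset.range (d + 1), catalan p * catalan (d - p)) *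
        (T.map fun c => catalan (c - 1)).prod := by
    rw [catalanProd, hT, Multiset.map_cons, Multiset.prod_cons, hd]
    congr 1
    rw [show d + 2 - 1 = d + 1 by omega, catalan_succ,
      Finset.sum_range fun p => catalan p * catalan (d - p)]
  rw [h2, Finset.sum_mul, hd]
  refine Finset.sum_congr rfl fun p hpd => ?_
  have := Finset.mem_range.1 hpd
  rw [catalanProd, hp (p + 1) (by omega) (by omega), Multiset.map_add, Multiset.map_add,
    Multiset.prod_add, Multiset.prod_add, prod_singleCycleType, prod_singleCycleType, hd]
  congr 3; omega

omit [Fintype α] in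
theorem sameCycle_swap_mul [Finite α] {σ : Perm α} {x i : α} (h : ¬ σ.SameCycle x i) :
    (swap x i * σ).SameCycle x i := by
  set c := Function.minimalPeriod σ x with hc
  have hc0 : 0 < c :=
    Function.minimalPeriod_pos_of_mem_periodicPts (σ.injective.mem_periodicPts x)
  have hcx : (σ ^ c) x = x := by
    rw [← iterate_eq_pow]; exact Function.iterate_minimalPeriod
  have key : ∀ m < c, ((swap x i * σ) ^ m) x = (σ ^ m) x := by
    intro m
    induction m with
    | zero => simp
    | succ m ih =>
      intro hm
      rw [pow_succ', Perm.mul_apply, ih (by omega), Perm.mul_apply, ← Perm.mul_apply σ,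
        ← pow_succ', swap_apply_of_ne_of_ne]
      · rw [← iterate_eq_pow]
        exact Function.not_isPeriodicPt_of_pos_of_lt_minimalPeriod (by omega) hm
      · intro h'
        exact h ⟨(m + 1 : ℕ), by rw [zpow_natCast, h']⟩
  refine ⟨(c : ℕ), ?_⟩
  obtain ⟨d, hd⟩ : ∃ d, c = d + 1 := ⟨c - 1, by omega⟩
  rw [zpow_natCast, hd, pow_succ', Perm.mul_apply, key d (by omega), Perm.mul_apply,
    ← Perm.mul_apply σ, ← pow_succ', ← hd, hcx, swap_apply_left]

theorem absLength_swap_mul_of_not_sameCycle {σ : Perm α} {x i : α} (h : ¬ σ.SameCycle x i) :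
    absLength (swap x i * σ) = absLength σ + 1 := by
  have hi : i ≠ x := by rintro rfl; exact h (SameCycle.refl _ _)
  rw [← absLength_swap_mul_of_sameCycle (sameCycle_swap_mul h) hi, swap_mul_self_mul]

theorem pow_le_mul_centralBinom_sq (n : ℕ) : 16 ^ n ≤ (4 * n + 1) * n.centralBinom ^ 2 := by
  induction n with
  | zero => simp
  | succ n ih =>
    have e : ((n + 1) * (n + 1).centralBinom) ^ 2 = (2 * (2 * n + 1) * n.centralBinom) ^ 2 := by
      rw [Nat.succ_mul_centralBinom_succ]
    have h : (0 : ℕ) < (n + 1) ^ 2 := by positivity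
    refine Nat.le_of_mul_le_mul_left ?_ h
    calc (n + 1) ^ 2 * 16 ^ (n + 1) = 16 * (n + 1) ^ 2 * 16 ^ n := by ring
      _ ≤ 16 * (n + 1) ^ 2 * ((4 * n + 1) * n.centralBinom ^ 2) := by gcongr
      _ ≤ (4 * (n + 1) + 1) * (2 * (2 * n + 1) * n.centralBinom) ^ 2 := by
        ring_nf; gcongr; norm_num
      _ = _ := by rw [← e]; ring

theorem mul_centralBinom_sq_le_pow (n : ℕ) : (n + 1) * n.centralBinom ^ 2 ≤ 16 ^ n := by
  induction n with
  | zero => simp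
  | succ n ih =>
    have e : ((n + 1) * (n + 1).centralBinom) ^ 2 = (2 * (2 * n + 1) * n.centralBinom) ^ 2 := by
      rw [Nat.succ_mul_centralBinom_succ]
    have h : (0 : ℕ) < (n + 1) ^ 2 := by positivity
    refine Nat.le_of_mul_le_mul_left ?_ h
    calc (n + 1) ^ 2 * ((n + 1 + 1) * (n + 1).centralBinom ^ 2)
        = (n + 2) * (2 * (2 * n + 1) * n.centralBinom) ^ 2 := by rw [← e]; ring
      _ ≤ 16 * (n + 1) ^ 2 * ((n + 1) * n.centralBinom ^ 2) := by
        ring_nf; gcongr <;> norm_num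
      _ ≤ 16 * (n + 1) ^ 2 * 16 ^ n := by gcongr
      _ = _ := by ring

theorem catalan_add_succ_sq_le (a b : ℕ) :
    catalan (a + b + 1) ^ 2 ≤ 4 * (a + b + 2) ^ 3 * (catalan a * catalan b) ^ 2 := by
  have lower : ∀ n, 16 ^ n ≤ 4 * (n + 1) ^ 3 * catalan n ^ 2 := fun n =>
    calc 16 ^ n ≤ (4 * n + 1) * n.centralBinom ^ 2 := pow_le_mul_centralBinom_sq n
      _ ≤ (4 * (n + 1)) * n.centralBinom ^ 2 := by gcongr; omega
      _ = _ := by rw [← succ_mul_catalan_eq_centralBinom]; ring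
  have upper : (a + b + 2) ^ 3 * catalan (a + b + 1) ^ 2 ≤ 16 ^ (a + b + 1) :=
    calc _ = (a + b + 1 + 1) * (a + b + 1).centralBinom ^ 2 := by
          rw [← succ_mul_catalan_eq_centralBinom]; ring
      _ ≤ _ := mul_centralBinom_sq_le_pow _
  have amgm : 4 * ((a + 1) * (b + 1)) ≤ (a + b + 2) ^ 2 := by
    zify; nlinarith [sq_nonneg ((a : ℤ) - b)]
  have h : (0 : ℕ) < (a + b + 2) ^ 3 := by positivity
  refine Nat.le_of_mul_le_mul_left ?_ h
  calc (a + b + 2) ^ 3 * catalan (a + b + 1) ^ 2 ≤ 16 ^ (a + b + 1) := upper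
    _ = 16 * (16 ^ a * 16 ^ b) := by ring
    _ ≤ 16 * ((4 * (a + 1) ^ 3 * catalan a ^ 2) * (4 * (b + 1) ^ 3 * catalan b ^ 2)) := by
      gcongr <;> exact lower _
    _ = 4 * (4 * ((a + 1) * (b + 1))) ^ 3 * (catalan a * catalan b) ^ 2 := by ring
    _ ≤ 4 * ((a + b + 2) ^ 2) ^ 3 * (catalan a * catalan b) ^ 2 := by gcongr
    _ = _ := by ring

theorem catalanProd_swap_mul_le {σ : Perm α} {x i : α} (h : ¬ σ.SameCycle x i) {R : ℝ}
    (hR0 : 0 ≤ R) (hR : 4 * (Fintype.card α : ℝ) ^ 3 ≤ R ^ 2) :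
    (catalanProd (swap x i * σ) : ℝ) ≤ R * catalanProd σ := by
  have hi : i ≠ x := by rintro rfl; exact h (SameCycle.refl _ _)
  obtain ⟨a, b, m, hab, h1, h2⟩ := exists_catalanProd_swap_mul (sameCycle_swap_mul h) hi
  rw [swap_mul_self_mul] at h2
  rw [h1, h2]
  push_cast
  rw [← mul_assoc R]
  refine mul_le_mul_of_nonneg_right ?_ (Nat.cast_nonneg _)
  refine le_of_sq_le_sq ?_ (by positivity)
  calc (catalan (a + b + 1) : ℝ) ^ 2
      ≤ 4 * ((a : ℝ) + b + 2) ^ 3 * (catalan a * catalan b) ^ 2 := by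
        exact_mod_cast catalan_add_succ_sq_le a b
    _ ≤ 4 * (Fintype.card α : ℝ) ^ 3 * (catalan a * catalan b) ^ 2 := by
        gcongr; exact_mod_cast hab
    _ ≤ R ^ 2 * (catalan a * catalan b) ^ 2 := by gcongr
    _ = _ := by ring

theorem catalanProd_pos (σ : Perm α) : 0 < catalanProd σ := by
  refine Multiset.prod_pos ?_
  simp only [Multiset.mem_map, forall_exists_index, and_imp]
  rintro _ c - rfl
  refine Nat.pos_of_ne_zero fun h => ?_
  have := succ_mul_catalan_eq_centralBinom (c - 1)
  rw [h, mul_zero] at this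
  exact Nat.centralBinom_ne_zero _ this.symm

theorem absLength_eq_zero {σ : Perm α} : absLength σ = 0 ↔ σ = 1 := by
  refine ⟨fun h => ?_, by rintro rfl; simp [absLength]⟩
  rw [← cycleType_eq_zero]
  refine Multiset.eq_zero_of_forall_notMem fun c hc => ?_
  have := two_le_of_mem_cycleType hc
  have h' := Multiset.sum_eq_zero_iff.1 h (c - 1) (Multiset.mem_map_of_mem _ hc)
  omega

theorem absLength_add_card (σ : Perm α) :
    absLength σ + σ.cycleType.card = #σ.support := by
  rw [← sum_cycleType, absLength]
  have : ∀ s : Multiset ℕ, (∀ c ∈ s, 2 ≤ c) → (s.map fun c => c - 1).sum + s.card = s.sum := by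
    intro s
    induction s using Multiset.induction with
    | empty => simp
    | cons a s ih =>
      intro h
      have h1 := h a (by simp)
      have h2 := ih fun c hc => h c (by simp [hc])
      simp only [Multiset.map_cons, Multiset.sum_cons, Multiset.card_cons]
      omega
  exact this _ fun c => two_le_of_mem_cycleType

theorem absLength_le_card (σ : Perm α) : absLength σ ≤ Fintype.card α := by
  have := absLength_add_card σ
  have : #σ.support ≤ Fintype.card α := card_le_univ _
  omega

/-- The number of monotone factorizations of `σ` into `l` transpositions `(x i)`, where `x` runs
through the list weakly monotonically and `i` comes after `x` in the list. -/
def monoCount : List α → ℕ → Perm α → ℕ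
  | [], l, σ => if l = 0 ∧ σ = 1 then 1 else 0
  | _ :: xs, 0, σ => monoCount xs 0 σ
  | x :: xs, l + 1, σ =>
    ∑ i ∈ xs.toFinset, monoCount (x :: xs) l (swap x i * σ) + monoCount xs (l + 1) σ

omit [Fintype α] in
theorem swap_mul_apply_ne {σ : Perm α} {x i y : α} (hx : y ≠ x) (hi : y ≠ i) (h : σ y ≠ y) :
    (swap x i * σ) y ≠ y := fun h' => h <| by
  rw [Perm.mul_apply, swap_apply_eq_iff, swap_apply_of_ne_of_ne hx hi] at h'
  exact h'

theorem monoCount_eq_zero_of_apply_ne {y : α} : ∀ {xs : List α} {l : ℕ} {σ : Perm α},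
    y ∉ xs → σ y ≠ y → monoCount xs l σ = 0
  | [], l, σ, _, h => by
    rw [monoCount, if_neg]
    rintro ⟨-, rfl⟩
    simp at h
  | x :: xs, 0, σ, hy, h => by
    rw [monoCount]
    exact monoCount_eq_zero_of_apply_ne (List.not_mem_of_not_mem_cons hy) h
  | x :: xs, l + 1, σ, hy, h => by
    rw [monoCount, monoCount_eq_zero_of_apply_ne (List.not_mem_of_not_mem_cons hy) h, add_zero]
    refine Finset.sum_eq_zero fun i hi => monoCount_eq_zero_of_apply_ne hy ?_
    refine swap_mul_apply_ne (List.ne_of_not_mem_cons hy) ?_ h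
    rintro rfl
    exact hy (List.mem_cons_of_mem _ (by simpa using hi))

theorem exists_eq_of_monoCount_ne_zero : ∀ {xs : List α} {l : ℕ} {σ : Perm α},
    xs.Nodup → monoCount xs l σ ≠ 0 → ∃ g, l = absLength σ + 2 * g
  | [], l, σ, _, h => by
    rw [monoCount] at h
    obtain ⟨rfl, rfl⟩ : l = 0 ∧ σ = 1 := by by_contra h'; simp [h'] at h
    exact ⟨0, by simp [absLength]⟩
  | x :: xs, 0, σ, hn, h => by
    rw [monoCount] at h
    exact exists_eq_of_monoCount_ne_zero (List.nodup_cons.1 hn).2 h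
  | x :: xs, l + 1, σ, hn, h => by
    rw [monoCount] at h
    by_cases h0 : monoCount xs (l + 1) σ = 0
    · rw [h0, add_zero] at h
      obtain ⟨i, hi, hne⟩ := Finset.exists_ne_zero_of_sum_ne_zero h
      obtain ⟨g, hg⟩ := exists_eq_of_monoCount_ne_zero hn hne
      have hix : i ≠ x := by
        rintro rfl; exact (List.nodup_cons.1 hn).1 (by simpa using hi)
      by_cases hs : σ.SameCycle x i
      · have := absLength_swap_mul_of_sameCycle hs hix
        exact ⟨g, by omega⟩
      · have := absLength_swap_mul_of_not_sameCycle hs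
        exact ⟨g + 1, by omega⟩
    · exact exists_eq_of_monoCount_ne_zero (List.nodup_cons.1 hn).2 h0

theorem sum_catalanProd_swap_mul_add {x : α} {xs : List α} (hn : (x :: xs).Nodup) {σ : Perm α}
    (hσ : ∀ y ∉ x :: xs, σ y = y) :
    ∑ i ∈ xs.toFinset with σ.SameCycle x i, catalanProd (swap x i * σ) +
      (if σ x = x then catalanProd σ else 0) = catalanProd σ := by
  have hx : x ∉ xs := (List.nodup_cons.1 hn).1
  split_ifs with h
  · rw [Finset.sum_eq_zero, zero_add]
    intro i hi
    rw [mem_filter, List.mem_toFinset] at hi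
    exact absurd h (apply_ne_of_sameCycle hi.2 (by rintro rfl; exact hx hi.1))
  · rw [add_zero, ← sum_catalanProd_swap_mul σ x h]
    refine Finset.sum_congr ?_ fun _ _ => rfl
    ext i
    simp only [mem_filter, List.mem_toFinset, mem_univ, true_and]
    refine ⟨fun hi => ⟨hi.2, by rintro rfl; exact hx hi.1⟩, fun hi => ⟨?_, hi.1⟩⟩
    by_contra hi'
    refine hi.2 (hi.1.symm.eq_of_left (hσ i ?_))
    simp [hi.2, hi']

omit [Fintype α] in
theorem swap_mul_apply_eq {x i y : α} {xs : List α} {σ : Perm α} (hi : i ∈ xs)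
    (hσ : ∀ y ∉ x :: xs, σ y = y) (hy : y ∉ x :: xs) : (swap x i * σ) y = y := by
  rw [Perm.mul_apply, hσ y hy, swap_apply_of_ne_of_ne (List.ne_of_not_mem_cons hy)]
  rintro rfl
  exact hy (List.mem_cons_of_mem _ hi)

theorem monoCount_absLength : ∀ {xs : List α} {σ : Perm α}, xs.Nodup →
    (∀ y ∉ xs, σ y = y) → monoCount xs (absLength σ) σ = catalanProd σ
  | [], σ, _, hσ => by
    obtain rfl : σ = 1 := Equiv.ext fun y => hσ y (by simp)
    simp [monoCount, absLength, catalanProd]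
  | x :: xs, σ, hn, hσ => by
    have hn' := (List.nodup_cons.1 hn)
    have tail : monoCount xs (absLength σ) σ = if σ x = x then catalanProd σ else 0 := by
      split_ifs with h
      · refine monoCount_absLength hn'.2 fun y hy => ?_
        rcases eq_or_ne y x with rfl | hyx
        · exact h
        · exact hσ y (by simp [hyx, hy])
      · exact monoCount_eq_zero_of_apply_ne hn'.1 h
    rcases hl : absLength σ with - | l
    · obtain rfl := absLength_eq_zero.1 hl
      rw [monoCount, ← hl, tail, if_pos (by simp)]
    · rw [monoCount, ← hl, tail]
      conv_rhs => rw [← sum_catalanProd_swap_mul_add hn hσ, Finset.sum_filter]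
      congr 1
      refine Finset.sum_congr rfl fun i hi => ?_
      rw [List.mem_toFinset] at hi
      have hix : i ≠ x := by rintro rfl; exact hn'.1 hi
      split_ifs with hs
      · have := absLength_swap_mul_of_sameCycle hs hix
        obtain rfl : l = absLength (swap x i * σ) := by omega
        exact monoCount_absLength hn fun y hy => swap_mul_apply_eq hi hσ hy
      · by_contra h0
        obtain ⟨g, hg⟩ := exists_eq_of_monoCount_ne_zero hn h0
        have := absLength_swap_mul_of_not_sameCycle hs
        omega
  termination_by xs σ => (xs.length, absLength σ)

theorem length_mul_monoCount_le {x : α} {xs : List α} (hn : (x :: xs).Nodup) (l : ℕ)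
    (σ : Perm α) : xs.length * monoCount (x :: xs) l σ ≤ monoCount (x :: xs) (l + 2) σ := by
  rw [monoCount, ← List.toFinset_card_of_nodup (List.nodup_cons.1 hn).2, ← smul_eq_mul]
  refine le_add_right (Finset.card_nsmul_le_sum _ _ _ fun i hi => ?_)
  rw [monoCount]
  refine le_add_right ?_
  calc monoCount (x :: xs) l σ = monoCount (x :: xs) l (swap x i * (swap x i * σ)) := by
        rw [swap_mul_self_mul]
    _ ≤ _ := Finset.single_le_sum (f := fun j => monoCount (x :: xs) l (swap x j * (swap x i * σ)))
        (fun _ _ => Nat.zero_le _) hi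

theorem pow_mul_catalanProd_le {x : α} {xs : List α} (hn : (x :: xs).Nodup) {σ : Perm α}
    (hσ : ∀ y ∉ x :: xs, σ y = y) (g : ℕ) :
    xs.length ^ g * catalanProd σ ≤ monoCount (x :: xs) (absLength σ + 2 * g) σ := by
  induction g with
  | zero => simp [monoCount_absLength hn hσ]
  | succ g ih =>
    calc xs.length ^ (g + 1) * catalanProd σ
        = xs.length * (xs.length ^ g * catalanProd σ) := by ring
      _ ≤ xs.length * monoCount (x :: xs) (absLength σ + 2 * g) σ := by gcongr
      _ ≤ _ := length_mul_monoCount_le hn _ _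

theorem monoCount_succ_genus_le {R B : ℝ} (hR0 : 0 ≤ R) (hB : 0 ≤ B)
    (hR : 4 * (Fintype.card α : ℝ) ^ 3 ≤ R ^ 2) {g : ℕ}
    (hg : ∀ (xs : List α) (σ : Perm α), xs.Nodup → (∀ y ∉ xs, σ y = y) →
      (monoCount xs (absLength σ + 2 * g) σ : ℝ) ≤ B * catalanProd σ) :
    ∀ (xs : List α) (σ : Perm α), xs.Nodup → (∀ y ∉ xs, σ y = y) →
      (monoCount xs (absLength σ + 2 * (g + 1)) σ : ℝ) ≤
        (Fintype.card α * R * B) * (xs.length + absLength σ) * catalanProd σ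
  | [], σ, _, _ => by
    rw [monoCount, if_neg (by omega)]
    push_cast
    positivity
  | x :: xs, σ, hn, hσ => by
    have hn' := List.nodup_cons.1 hn
    set D : ℝ := Fintype.card α * R * B with hD
    have hD0 : 0 ≤ D := by positivity
    have tail : (monoCount xs (absLength σ + 2 * (g + 1)) σ : ℝ) ≤
        D * (xs.length + absLength σ) * (if σ x = x then catalanProd σ else 0 : ℕ) := by
      split_ifs with h
      · refine monoCount_succ_genus_le hR0 hB hR hg xs σ hn'.2 fun y hy => ?_
        rcases eq_or_ne y x with rfl | hyx
        · exact h
        · exact hσ y (by simp [hyx, hy])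
      · rw [monoCount_eq_zero_of_apply_ne hn'.1 h]; simp
    have same : (∑ i ∈ xs.toFinset with σ.SameCycle x i,
          (monoCount (x :: xs) (absLength σ + 2 * g + 1) (swap x i * σ) : ℝ)) ≤
        D * (xs.length + absLength σ) *
          (∑ i ∈ xs.toFinset with σ.SameCycle x i, catalanProd (swap x i * σ) : ℕ) := by
      push_cast
      rw [Finset.mul_sum]
      refine Finset.sum_le_sum fun i hi => ?_
      rw [mem_filter, List.mem_toFinset] at hi
      have hix : i ≠ x := by rintro rfl; exact hn'.1 hi.1
      have hlen := absLength_swap_mul_of_sameCycle hi.2 hix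
      have := monoCount_succ_genus_le hR0 hB hR hg (x :: xs) (swap x i * σ) hn
        fun y hy => swap_mul_apply_eq hi.1 hσ hy
      rw [show absLength σ + 2 * g + 1 = absLength (swap x i * σ) + 2 * (g + 1) by omega]
      refine this.trans_eq ?_
      rw [← hlen]
      push_cast [List.length_cons]
      ring
    have diff : (∑ i ∈ xs.toFinset with ¬ σ.SameCycle x i,
          (monoCount (x :: xs) (absLength σ + 2 * g + 1) (swap x i * σ) : ℝ)) ≤
        D * catalanProd σ := by
      calc _ ≤ ∑ i ∈ xs.toFinset with ¬ σ.SameCycle x i, B * (R * catalanProd σ) := by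
            refine Finset.sum_le_sum fun i hi => ?_
            rw [mem_filter, List.mem_toFinset] at hi
            have hlen := absLength_swap_mul_of_not_sameCycle hi.2
            rw [show absLength σ + 2 * g + 1 = absLength (swap x i * σ) + 2 * g by omega]
            refine (hg _ _ hn fun y hy => swap_mul_apply_eq hi.1 hσ hy).trans ?_
            gcongr
            exact catalanProd_swap_mul_le hi.2 hR0 hR
        _ ≤ Fintype.card α * (B * (R * catalanProd σ)) := by
            rw [Finset.sum_const, nsmul_eq_mul]
            gcongr
            exact card_le_univ _
        _ = _ := by ring
    have hrec := sum_catalanProd_swap_mul_add hn hσ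
    rw [show absLength σ + 2 * (g + 1) = absLength σ + 2 * g + 1 + 1 by ring] at tail ⊢
    rw [monoCount]
    push_cast
    rw [← Finset.sum_filter_add_sum_filter_not xs.toFinset (fun i => σ.SameCycle x i)]
    calc _ ≤ D * (xs.length + absLength σ) *
          (∑ i ∈ xs.toFinset with σ.SameCycle x i, catalanProd (swap x i * σ) : ℕ) +
          D * catalanProd σ + D * (xs.length + absLength σ) *
            (if σ x = x then catalanProd σ else 0 : ℕ) := by gcongr
      _ = D * (xs.length + absLength σ) * ((∑ i ∈ xs.toFinset with σ.SameCycle x i,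
            catalanProd (swap x i * σ) + if σ x = x then catalanProd σ else 0 : ℕ) : ℝ) +
          D * catalanProd σ := by push_cast; ring
      _ = _ := by rw [hrec]; push_cast [List.length_cons]; ring
  termination_by xs σ => (xs.length, absLength σ)

theorem monoCount_le {R : ℝ} (hR0 : 0 ≤ R) (hR : 4 * (Fintype.card α : ℝ) ^ 3 ≤ R ^ 2) (g : ℕ) :
    ∀ (xs : List α) (σ : Perm α), xs.Nodup → (∀ y ∉ xs, σ y = y) →
      (monoCount xs (absLength σ + 2 * g) σ : ℝ) ≤
        (2 * Fintype.card α ^ 2 * R) ^ g * catalanProd σ := by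
  induction g with
  | zero =>
    intro xs σ hn hσ
    simp [monoCount_absLength hn hσ]
  | succ g ih =>
    intro xs σ hn hσ
    refine (monoCount_succ_genus_le hR0 (by positivity) hR ih xs σ hn hσ).trans ?_
    have h1 : (xs.length : ℝ) ≤ Fintype.card α := by exact_mod_cast hn.length_le_card
    have h2 : (absLength σ : ℝ) ≤ Fintype.card α := by exact_mod_cast absLength_le_card σ
    calc _ ≤ Fintype.card α * R * (2 * Fintype.card α ^ 2 * R) ^ g *
          (Fintype.card α + Fintype.card α) * catalanProd σ := by gcongr
      _ = _ := by ring

/-- The function `t ^ |σ|` on the permutations supported in the list `xs`, extended by zero. -/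
noncomputable def lengthWeight (xs : List α) (t : ℝ) (σ : Perm α) : ℝ :=
  open Classical in if ∀ y ∉ xs, σ y = y then t ^ absLength σ else 0

/-- The alternating generating series of the monotone factorization counts. -/
noncomputable def monoSeries (xs : List α) (t : ℝ) (σ : Perm α) : ℝ :=
  ∑' l, (-t) ^ l * (monoCount xs l σ : ℝ)

theorem absLength_mul_swap (σ : Perm α) (x i : α) :
    absLength (σ * swap x i) = absLength (swap x i * σ) := by
  rw [absLength, absLength, ← cycleType_conj (σ := σ * swap x i) (τ := swap x i)]
  congr 3
  simp [mul_assoc]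

theorem lengthWeight_cons {x : α} {xs : List α} (hn : (x :: xs).Nodup) (t : ℝ) (σ : Perm α) :
    lengthWeight (x :: xs) t σ =
      lengthWeight xs t σ + t * ∑ i ∈ xs.toFinset, lengthWeight xs t (σ * swap x i) := by
  have hx : x ∉ xs := (List.nodup_cons.1 hn).1
  have zero : ∀ {ys : List α} {τ : Perm α} (y : α), y ∉ ys → τ y ≠ y →
      lengthWeight ys t τ = 0 := fun y hy h => if_neg fun h' => h (h' y hy)
  by_cases hσ : ∀ y ∉ x :: xs, σ y = y
  · have hfix : ∀ τ : Perm α, (∀ y ∉ x :: xs, τ y = y) → τ x = x →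
        lengthWeight xs t τ = t ^ absLength τ := fun τ hτ hτx => if_pos fun y hy => by
      rcases eq_or_ne y x with rfl | hyx
      · exact hτx
      · exact hτ y (by simp [hyx, hy])
    have hmul : ∀ i ∈ xs, ∀ y ∉ x :: xs, (σ * swap x i) y = y := fun i hi y hy => by
      rw [Perm.mul_apply, swap_apply_of_ne_of_ne (List.ne_of_not_mem_cons hy), hσ y hy]
      rintro rfl
      exact hy (List.mem_cons_of_mem _ hi)
    have lhs : lengthWeight (x :: xs) t σ = t ^ absLength σ := if_pos hσ
    by_cases h : σ x = x
    · rw [lhs, hfix σ hσ h, Finset.sum_eq_zero, mul_zero, add_zero]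
      intro i hi
      refine zero x hx ?_
      rw [Perm.mul_apply, swap_apply_left]
      intro hi'
      obtain rfl : i = x := σ.injective (hi'.trans h.symm)
      exact hx (by simpa using hi)
    · obtain ⟨j, hj⟩ := σ.surjective x
      have hne : j ≠ x := by rintro rfl; exact h hj
      have hmem : j ∈ xs := by
        by_contra h'
        exact hne ((hσ j (by simp [hne, h'])).symm.trans hj)
      have hs : σ.SameCycle x j := SameCycle.symm ⟨1, by simpa using hj⟩
      rw [lhs, zero x hx h, zero_add, Finset.sum_eq_single_of_mem j (by simpa using hmem),
        hfix _ (hmul _ hmem) (by simpa using hj), absLength_mul_swap,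
        ← absLength_swap_mul_of_sameCycle hs hne, pow_succ']
      intro i _ hi
      refine zero x hx fun h' => hi ?_
      rw [Perm.mul_apply, swap_apply_left] at h'
      exact σ.injective (h'.trans hj.symm)
  · push Not at hσ
    obtain ⟨y, hy, hne⟩ := hσ
    have hy' := List.not_mem_of_not_mem_cons hy
    rw [zero y hy hne, zero y hy' hne, Finset.sum_eq_zero, mul_zero, add_zero]
    intro i hi
    refine zero y hy' ?_
    rw [Perm.mul_apply, swap_apply_of_ne_of_ne (List.ne_of_not_mem_cons hy)]
    · exact hne
    · rintro rfl
      exact hy' (by simpa using hi)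

theorem exists_sum_monoCount_le {t : ℝ} (ht : 0 ≤ t) : ∀ {xs : List α}, xs.Nodup →
    ((xs.length : ℝ) - 1) * t < 1 →
    ∃ B : ℝ, ∀ L, ∑ l ∈ range L, (∑ σ : Perm α, monoCount xs l σ : ℕ) * t ^ l ≤ B
  | [], _, _ => by
    refine ⟨1, fun L => ?_⟩
    calc _ ≤ ∑ l ∈ range L, if l = 0 then (1 : ℝ) else 0 := by
          refine Finset.sum_le_sum fun l _ => ?_
          rcases l with - | l <;> simp [monoCount]
      _ ≤ 1 := by
          rw [Finset.sum_ite_eq']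
          split_ifs <;> norm_num
  | x :: xs, hn, hxs => by
    have hn' := List.nodup_cons.1 hn
    have hq : xs.length * t < 1 := by simpa using hxs
    obtain ⟨B, hB⟩ := exists_sum_monoCount_le ht hn'.2 (by linarith)
    have hB0 : 0 ≤ B := by simpa using hB 0
    have rec0 : ∑ σ : Perm α, monoCount (x :: xs) 0 σ = ∑ σ : Perm α, monoCount xs 0 σ := by
      simp only [monoCount]
    have rec1 : ∀ l, ∑ σ : Perm α, monoCount (x :: xs) (l + 1) σ =
        xs.length * ∑ σ : Perm α, monoCount (x :: xs) l σ +
          ∑ σ : Perm α, monoCount xs (l + 1) σ := by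
      intro l
      simp only [monoCount]
      rw [Finset.sum_add_distrib, Finset.sum_comm]
      congr 1
      have reindex : ∀ i ∈ xs.toFinset, ∑ σ : Perm α, monoCount (x :: xs) l (swap x i * σ) =
          ∑ σ : Perm α, monoCount (x :: xs) l σ := fun i _ =>
        Equiv.sum_comp (Equiv.mulLeft (swap x i)) (monoCount (x :: xs) l)
      rw [Finset.sum_congr rfl reindex, Finset.sum_const, smul_eq_mul, List.toFinset_card_of_nodup hn'.2]
    refine ⟨B / (1 - xs.length * t), fun L => ?_⟩
    induction L with
    | zero => simpa using div_nonneg hB0 (by linarith)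
    | succ L ih =>
      have hS := hB (L + 1)
      rw [Finset.sum_range_succ'] at hS ⊢
      have : ∑ l ∈ range L, ((∑ σ : Perm α, monoCount (x :: xs) (l + 1) σ : ℕ) : ℝ) * t ^ (l + 1) =
          xs.length * t * ∑ l ∈ range L, ((∑ σ : Perm α, monoCount (x :: xs) l σ : ℕ) : ℝ) * t ^ l +
            ∑ l ∈ range L, ((∑ σ : Perm α, monoCount xs (l + 1) σ : ℕ) : ℝ) * t ^ (l + 1) := by
        rw [Finset.mul_sum, ← Finset.sum_add_distrib]
        refine Finset.sum_congr rfl fun l _ => ?_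
        rw [rec1]
        push_cast
        ring
      rw [this, rec0]
      have h1 : xs.length * t * ∑ l ∈ range L,
          ((∑ σ : Perm α, monoCount (x :: xs) l σ : ℕ) : ℝ) * t ^ l ≤
          xs.length * t * (B / (1 - xs.length * t)) := by gcongr
      have h2 : B / (1 - xs.length * t) = xs.length * t * (B / (1 - xs.length * t)) + B := by
        field_simp [(by linarith : 1 - xs.length * t ≠ 0)]
        ring
      linarith

theorem summable_monoCount {t : ℝ} (ht : 0 ≤ t) {xs : List α} (hn : xs.Nodup)
    (hxs : ((xs.length : ℝ) - 1) * t < 1) (σ : Perm α) :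
    Summable fun l => (-t) ^ l * (monoCount xs l σ : ℝ) := by
  obtain ⟨B, hB⟩ := exists_sum_monoCount_le ht hn hxs
  have hs := summable_of_sum_range_le (fun l => by positivity) hB
  refine hs.of_norm_bounded fun l => ?_
  rw [norm_mul, norm_pow, norm_neg, Real.norm_of_nonneg ht, mul_comm,
    Real.norm_of_nonneg (Nat.cast_nonneg _)]
  gcongr
  exact Finset.single_le_sum (f := fun σ => monoCount xs l σ) (fun _ _ => Nat.zero_le _)
    (mem_univ σ)

theorem monoSeries_cons {t : ℝ} (ht : 0 ≤ t) {x : α} {xs : List α} (hn : (x :: xs).Nodup)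
    (hxs : (xs.length : ℝ) * t < 1) (σ : Perm α) :
    monoSeries (x :: xs) t σ + t * ∑ i ∈ xs.toFinset, monoSeries (x :: xs) t (swap x i * σ) =
      monoSeries xs t σ := by
  have hn' := List.nodup_cons.1 hn
  have s1 := summable_monoCount ht hn (by simpa using hxs)
  have s2 := summable_monoCount ht hn'.2 (by linarith) σ
  unfold monoSeries
  rw [(s1 σ).tsum_eq_zero_add, s2.tsum_eq_zero_add, ← Summable.tsum_finsetSum fun i _ => s1 _]
  have e : ∀ l, (-t) ^ (l + 1) * (monoCount (x :: xs) (l + 1) σ : ℝ) =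
      -t * ∑ i ∈ xs.toFinset, (-t) ^ l * (monoCount (x :: xs) l (swap x i * σ) : ℝ) +
        (-t) ^ (l + 1) * (monoCount xs (l + 1) σ : ℝ) := fun l => by
    rw [monoCount]
    push_cast
    rw [← Finset.mul_sum]
    ring
  simp only [e]
  rw [Summable.tsum_add ((summable_sum fun i _ => s1 _).mul_left _)
    ((summable_nat_add_iff 1).2 s2), tsum_mul_left, monoCount]
  ring

theorem sum_lengthWeight_mul_monoSeries {t : ℝ} (ht : 0 ≤ t) : ∀ {xs : List α}, xs.Nodup →
    ((xs.length : ℝ) - 1) * t < 1 → ∀ σ : Perm α,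
    ∑ τ, lengthWeight xs t (σ * τ⁻¹) * monoSeries xs t τ = if σ = 1 then 1 else 0
  | [], _, _, σ => by
    have h1 : ∀ τ : Perm α, monoSeries [] t τ = if τ = 1 then 1 else 0 := fun τ => by
      rw [monoSeries, tsum_eq_single 0]
      · simp [monoCount]
      · intro l hl
        simp [monoCount, hl]
    have h2 : ∀ τ : Perm α, lengthWeight [] t τ = if τ = 1 then 1 else 0 := fun τ => by
      rw [lengthWeight]
      simp only [List.not_mem_nil, not_false_eq_true, forall_const]
      by_cases h : τ = 1
      · subst h; simp [absLength]
      · have h' : ¬ ∀ y, τ y = y := fun h' => h (Equiv.ext h')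
        rw [if_neg h, if_neg h']
    simp [h1, h2]
  | x :: xs, hn, hxs, σ => by
    have hn' := List.nodup_cons.1 hn
    have hq : xs.length * t < 1 := by simpa using hxs
    rw [← sum_lengthWeight_mul_monoSeries ht hn'.2 (by linarith) σ]
    simp only [lengthWeight_cons hn, ← monoSeries_cons ht hn hq, add_mul, mul_add,
      Finset.sum_add_distrib, Finset.mul_sum, Finset.sum_mul]
    congr 1
    rw [Finset.sum_comm, Finset.sum_comm (s := univ)]
    refine Finset.sum_congr rfl fun i _ => ?_
    rw [← Equiv.sum_comp (Equiv.mulLeft (swap x i))]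
    refine Finset.sum_congr rfl fun τ _ => ?_
    simp only [Equiv.coe_mulLeft, mul_inv_rev, swap_inv, mul_assoc, swap_mul_self, mul_one]
    ring

theorem monoSeries_eq {t : ℝ} {xs : List α} (hn : xs.Nodup) (σ : Perm α) :
    monoSeries xs t σ = (-t) ^ absLength σ *
      ∑' g, (t ^ 2) ^ g * (monoCount xs (absLength σ + 2 * g) σ : ℝ) := by
  have hinj : Function.Injective fun g => absLength σ + 2 * g := fun a b h => by
    simp only at h; omega
  rw [monoSeries, ← tsum_mul_left, ← hinj.tsum_eq]
  · refine tsum_congr fun g => ?_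
    rw [pow_add, pow_mul (-t), neg_sq, mul_assoc]
  · intro l hl
    have : monoCount xs l σ ≠ 0 := fun h => hl (by simp [h])
    obtain ⟨g, rfl⟩ := exists_eq_of_monoCount_ne_zero hn this
    exact ⟨g, rfl⟩

theorem one_div_one_sub_le_tsum {t A : ℝ} {f : ℕ → ℝ} (hA : 0 ≤ A) (hAt : A * t < 1) (ht : 0 ≤ t)
    (hf : ∀ g, A ^ g ≤ f g) (hs : Summable fun g => t ^ g * f g) :
    1 / (1 - A * t) ≤ ∑' g, t ^ g * f g := by
  rw [one_div, ← tsum_geometric_of_lt_one (by positivity) hAt]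
  refine (summable_geometric_of_lt_one (by positivity) hAt).tsum_le_tsum (fun g => ?_) hs
  rw [mul_pow, mul_comm]
  gcongr
  exact hf g

theorem tsum_le_one_div_one_sub {t A : ℝ} {f : ℕ → ℝ} (hA : 0 ≤ A) (hAt : A * t < 1) (ht : 0 ≤ t)
    (hf : ∀ g, f g ≤ A ^ g) (hs : Summable fun g => t ^ g * f g) :
    ∑' g, t ^ g * f g ≤ 1 / (1 - A * t) := by
  rw [one_div, ← tsum_geometric_of_lt_one (by positivity) hAt]
  refine hs.tsum_le_tsum (fun g => ?_) (summable_geometric_of_lt_one (by positivity) hAt)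
  rw [mul_pow, mul_comm]
  gcongr
  exact hf g

theorem cycleCount_add_absLength {k : ℕ} (σ : Perm (Fin k)) :
    cycleCount σ + absLength σ = k := by
  have h1 := absLength_add_card σ
  have h2 := Finset.card_filter_add_card_filter_not (s := univ) (fun a : Fin k => σ a = a)
  have h3 : #σ.support = #{a : Fin k | ¬ σ a = a} := by
    congr 1
  rw [card_univ, Fintype.card_fin] at h2
  unfold cycleCount
  omega

theorem Moeb_eq {k : ℕ} (σ : Perm (Fin k)) :
    Moeb σ = (-1) ^ absLength σ * (catalanProd σ : ℝ) := by
  rw [Moeb, absLength, catalanProd, Multiset.prod_map_mul]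
  congr 1
  · induction σ.cycleType using Multiset.induction <;> simp_all [pow_add]
  · rw [← Nat.coe_castRingHom, map_multiset_prod, Multiset.map_map]
    rfl

theorem Wg_eq {k n : ℕ} (hn0 : 0 < n) (hn : k ≤ n) (σ : Perm (Fin k)) :
    Wg k n σ = ((n : ℝ) ^ k)⁻¹ * monoSeries (univ : Finset (Fin k)).toList (n : ℝ)⁻¹ σ := by
  have hn' : (0 : ℝ) < n := by exact_mod_cast hn0
  have hlen : (((univ : Finset (Fin k)).toList.length : ℝ) - 1) * (n : ℝ)⁻¹ < 1 := by
    rw [length_toList, card_univ, Fintype.card_fin, ← div_eq_mul_inv, div_lt_one hn']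
    have : (k : ℝ) ≤ n := by exact_mod_cast hn
    linarith
  have hgram : ∀ ρ : Perm (Fin k), (n : ℝ) ^ cycleCount ρ =
      n ^ k * lengthWeight (univ : Finset (Fin k)).toList (n : ℝ)⁻¹ ρ := fun ρ => by
    rw [lengthWeight, if_pos (by simp), inv_pow, ← div_eq_mul_inv,
      eq_div_iff (by positivity), ← pow_add, cycleCount_add_absLength]
  have hinv : gramMatrix k n * Matrix.of (fun σ τ => ((n : ℝ) ^ k)⁻¹ *
      monoSeries (univ : Finset (Fin k)).toList (n : ℝ)⁻¹ (σ * τ⁻¹)) = 1 := by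
    ext σ ρ
    rw [Matrix.mul_apply, Matrix.one_apply, ← Equiv.sum_comp (Equiv.mulRight ρ)]
    have := sum_lengthWeight_mul_monoSeries (inv_nonneg.2 hn'.le) (Finset.nodup_toList _) hlen
      (σ * ρ⁻¹)
    simp only [mul_inv_eq_one] at this
    rw [← this]
    refine Finset.sum_congr rfl fun τ _ => ?_
    simp only [gramMatrix, hgram, Matrix.of_apply, Equiv.coe_mulRight, mul_inv_rev, mul_inv_cancel, mul_one,
      mul_assoc]
    field_simp
  rw [Wg, Matrix.inv_eq_right_inv hinv, Matrix.of_apply, inv_one, mul_one]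

/-- The normalized count of monotone factorizations of genus `g`. -/
noncomputable def genusRatio {k : ℕ} (σ : Perm (Fin k)) (g : ℕ) : ℝ :=
  monoCount (univ : Finset (Fin k)).toList (absLength σ + 2 * g) σ / catalanProd σ

theorem Wg_ratio_eq {k n : ℕ} (hn0 : 0 < n) (hn : k ≤ n) (σ : Perm (Fin k)) :
    (n : ℝ) ^ (k + absLength σ) * Wg k n σ / Moeb σ =
      ∑' g, (((n : ℝ) ^ 2)⁻¹) ^ g * genusRatio σ g := by
  have hn' : (n : ℝ) ≠ 0 := by exact_mod_cast hn0.ne'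
  have hc : (catalanProd σ : ℝ) ≠ 0 := by exact_mod_cast (catalanProd_pos σ).ne'
  simp only [genusRatio, ← mul_div_assoc]
  rw [Wg_eq hn0 hn, Moeb_eq, monoSeries_eq (Finset.nodup_toList _), tsum_div_const, inv_pow]
  rw [pow_add, neg_eq_neg_one_mul, mul_pow, inv_pow]
  have h1 : (-1 : ℝ) ^ absLength σ ≠ 0 := by positivity
  field_simp

theorem summable_genusRatio {k n : ℕ} (hn0 : 0 < n) (hn : k ≤ n) (σ : Perm (Fin k)) :
    Summable fun g => (((n : ℝ) ^ 2)⁻¹) ^ g * genusRatio σ g := by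
  have hn' : (0 : ℝ) < n := by exact_mod_cast hn0
  have hlen : (((univ : Finset (Fin k)).toList.length : ℝ) - 1) * (n : ℝ)⁻¹ < 1 := by
    rw [length_toList, card_univ, Fintype.card_fin, ← div_eq_mul_inv, div_lt_one hn']
    have : (k : ℝ) ≤ n := by exact_mod_cast hn
    linarith
  have hs := summable_monoCount (inv_nonneg.2 hn'.le) (Finset.nodup_toList _) hlen σ
  have hinj : Function.Injective fun g => absLength σ + 2 * g := fun a b h => by
    simp only at h; omega
  have h0 : (-(n : ℝ)⁻¹) ^ absLength σ ≠ 0 := by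
    refine pow_ne_zero _ (neg_ne_zero.2 (inv_ne_zero hn'.ne'))
  have hs' := ((summable_mul_left_iff h0).1 <|
    (hs.comp_injective hinj).congr fun g => show _ = (-(n : ℝ)⁻¹) ^ absLength σ *
      ((((n : ℝ) ^ 2)⁻¹) ^ g * monoCount (univ : Finset (Fin k)).toList (absLength σ + 2 * g) σ) by
        simp only [Function.comp]
        rw [pow_add, pow_mul (-(n : ℝ)⁻¹), neg_sq, inv_pow, mul_assoc])
  exact (hs'.div_const (catalanProd σ : ℝ)).congr fun g => mul_div_assoc ..

theorem pow_le_genusRatio {k : ℕ} (hk : 1 ≤ k) (σ : Perm (Fin k)) (g : ℕ) :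
    ((k : ℝ) - 1) ^ g ≤ genusRatio σ g := by
  have hc : (0 : ℝ) < catalanProd σ := by exact_mod_cast catalanProd_pos σ
  rw [genusRatio, le_div_iff₀ hc]
  have hlen : (univ : Finset (Fin k)).toList.length = k := by simp
  have hnd := Finset.nodup_toList (univ : Finset (Fin k))
  have hmem : ∀ y, y ∈ (univ : Finset (Fin k)).toList := by simp
  rcases hL : (univ : Finset (Fin k)).toList with - | ⟨x, xs⟩
  · simp [hL] at hlen; omega
  · rw [hL] at hlen hnd hmem
    have := pow_mul_catalanProd_le hnd (fun y hy => absurd (hmem y) hy) (σ := σ) g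
    have hk' : (k : ℝ) - 1 = xs.length := by
      rw [sub_eq_iff_eq_add]
      exact_mod_cast hlen.symm
    rw [hk']
    exact_mod_cast this

theorem genusRatio_le_pow {k : ℕ} (σ : Perm (Fin k)) (g : ℕ) :
    genusRatio σ g ≤ (6 * (k : ℝ) ^ ((7 : ℝ) / 2)) ^ g := by
  have hc : (0 : ℝ) < catalanProd σ := by exact_mod_cast catalanProd_pos σ
  have hR : 4 * (Fintype.card (Fin k) : ℝ) ^ 3 ≤ (2 * (k : ℝ) ^ ((3 : ℝ) / 2)) ^ 2 := by
    rw [Fintype.card_fin, mul_pow, ← Real.rpow_mul_natCast (by positivity), ← Real.rpow_natCast]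
    norm_num
  rw [genusRatio, div_le_iff₀ hc]
  refine (monoCount_le (by positivity) hR g _ σ (Finset.nodup_toList _) (by simp)).trans ?_
  refine mul_le_mul_of_nonneg_right (pow_le_pow_left₀ (by positivity) ?_ _) hc.le
  rw [Fintype.card_fin, ← Real.rpow_natCast (k : ℝ) 2]
  have e : (k : ℝ) ^ ((7 : ℝ) / 2) = (k : ℝ) ^ ((2 : ℕ) : ℝ) * (k : ℝ) ^ ((3 : ℝ) / 2) := by
    rw [← Real.rpow_add_of_nonneg (by positivity) (by norm_num) (by norm_num)]
    norm_num
  rw [e]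
  have : 0 ≤ (k : ℝ) ^ ((2 : ℕ) : ℝ) * (k : ℝ) ^ ((3 : ℝ) / 2) := by positivity
  linarith

end WeingartenBound

/-- Uniform two-sided estimates for the unitary Weingarten function:
for `n ≥ k`, `1/(1 − (k−1)/n²) ≤ n^{k+|σ|} Wg(n,σ)/Moeb(σ)`, and for
`n > √6·k^{7/4}` also `n^{k+|σ|} Wg(n,σ)/Moeb(σ) ≤ 1/(1 − 6k^{7/2}/n²)`;
in particular in that range `Wg(n,σ)` is nonzero of the same sign as `Moeb(σ)`. -/
theorem stmt15 (k n : ℕ) (hk : 1 ≤ k) (hn : k ≤ n) (σ : Equiv.Perm (Fin k)) :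
    (1 / (1 - ((k : ℝ) - 1) / (n : ℝ) ^ 2)
        ≤ (n : ℝ) ^ (k + (k - cycleCount σ)) * Wg k n σ / Moeb σ) ∧
    (Real.sqrt 6 * (k : ℝ) ^ ((7 : ℝ) / 4) < (n : ℝ) →
      (n : ℝ) ^ (k + (k - cycleCount σ)) * Wg k n σ / Moeb σ
          ≤ 1 / (1 - 6 * (k : ℝ) ^ ((7 : ℝ) / 2) / (n : ℝ) ^ 2) ∧
        Wg k n σ ≠ 0 ∧ 0 < Wg k n σ * Moeb σ) := by
  have hn0 : 0 < n := by omega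
  have hn' : (0 : ℝ) < n := by exact_mod_cast hn0
  have hk' : (1 : ℝ) ≤ k := by exact_mod_cast hk
  have hkn : (k : ℝ) ≤ n := by exact_mod_cast hn
  have hcat : (0 : ℝ) < WeingartenBound.catalanProd σ := by
    exact_mod_cast WeingartenBound.catalanProd_pos σ
  have hlen : k - cycleCount σ = WeingartenBound.absLength σ := by
    have := WeingartenBound.cycleCount_add_absLength σ
    omega
  have hlt : ((k : ℝ) - 1) * ((n : ℝ) ^ 2)⁻¹ < 1 := by
    rw [← div_eq_mul_inv, div_lt_one (by positivity)]
    nlinarith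
  have hratio := WeingartenBound.Wg_ratio_eq hn0 hn σ
  have hsum := WeingartenBound.summable_genusRatio hn0 hn σ
  have ht : (0 : ℝ) ≤ ((n : ℝ) ^ 2)⁻¹ := by positivity
  have lower := WeingartenBound.one_div_one_sub_le_tsum (by linarith) hlt ht
    (WeingartenBound.pow_le_genusRatio hk σ) hsum
  rw [hlen, hratio, div_eq_mul_inv ((k : ℝ) - 1), div_eq_mul_inv (6 * _)]
  refine ⟨lower, fun h => ?_⟩
  have hpos : 0 < Wg k n σ / Moeb σ := by
    have h1 : 0 < (n : ℝ) ^ (k + WeingartenBound.absLength σ) * Wg k n σ / Moeb σ :=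
      hratio ▸ lt_of_lt_of_le (one_div_pos.2 (by linarith)) lower
    rw [mul_div_assoc] at h1
    exact pos_of_mul_pos_right h1 (by positivity)
  have hmul : 0 < Wg k n σ * Moeb σ := by
    rcases div_pos_iff.1 hpos with ⟨h1, h2⟩ | ⟨h1, h2⟩
    · exact mul_pos h1 h2
    · exact mul_pos_of_neg_of_neg h1 h2
  refine ⟨?_, left_ne_zero_of_mul hmul.ne', hmul⟩
  refine WeingartenBound.tsum_le_one_div_one_sub (by positivity) ?_ ht
    (WeingartenBound.genusRatio_le_pow σ) hsum
  rw [← div_eq_mul_inv, div_lt_one (by positivity)]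
  have hsq : 6 * (k : ℝ) ^ ((7 : ℝ) / 2) = (Real.sqrt 6 * (k : ℝ) ^ ((7 : ℝ) / 4)) ^ 2 := by
    rw [mul_pow, Real.sq_sqrt (by norm_num), ← Real.rpow_mul_natCast (by positivity)]
    norm_num
  rw [hsq]
  gcongr
end

section
/- Let H be a complex Hilbert space, l ≥ 1 an integer, b_1, …, b_l bounded linear operators on H, and i ↦ i* an involution of {1,…,l} (so i** = i for all i). Let B be the bounded operator on the l-fold Hilbert space direct sum H ⊕ ⋯ ⊕ H defined by (Bx)_i = Σ_{j : j ≠ i*} b_j x_j for x = (x_1,…,x_l). Let λ ∈ ℂ be such that λ² does not belong to the spectrum of b_{i*} b_i for any i ∈ {1,…,l}. Define the bounded operators on H: b_i(λ) = λ · b_i · (λ² − b_{i*} b_i)⁻¹ for 1 ≤ i ≤ l, b_0(λ) = −1 − Σ_{i=1}^{l} b_i (λ² − b_{i*} b_i)⁻¹ b_{i*}, and A_λ = b_0(λ) + Σ_{i=1}^{l} b_i(λ). Then λ belongs to the spectrum of B if and only if 0 belongs to the spectrum of A_λ. -/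
/-- The system `lam x_i + b_{i*} x_{i*} = z_i` is solved by
`x_i = (lam² - b_{i*} b_i)⁻¹ (lam z_i - b_{i*} z_{i*})`. -/
theorem involution_system_iff {R M ι : Type*} [CommRing R] [AddCommGroup M] [Module R M]
    (b r : ι → M →ₗ[R] M) (star : ι → ι) (hstar : ∀ i, star (star i) = i) (lam : R)
    (hr : ∀ i v, lam ^ 2 • r i v - b (star i) (b i (r i v)) = v)
    (hr' : ∀ i v, r i (lam ^ 2 • v - b (star i) (b i v)) = v) (x z : ι → M) :
    (∀ i, lam • x i + b (star i) (x (star i)) = z i) ↔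
      ∀ i, x i = r i (lam • z i - b (star i) (z (star i))) := by
  constructor
  · intro h i
    have h2 := h (star i)
    rw [hstar] at h2
    rw [← h i, ← h2]
    conv_lhs => rw [← hr' i (x i)]
    congr 1
    simp only [map_add, map_smul]
    module
  · intro h i
    have comm : ∀ v, b (star i) (r (star i) v) = r i (b (star i) v) := by
      intro v
      have h3 := hr (star i) v
      rw [hstar] at h3
      conv_rhs => rw [← h3]
      conv_lhs => rw [← hr' i (b (star i) (r (star i) v))]
      simp only [map_sub, map_smul]
    have h2 := h (star i)
    rw [hstar] at h2
    rw [h2, comm, h i, ← map_smul, ← map_add]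
    conv_rhs => rw [← hr' i (z i)]
    congr 1
    simp only [map_sub, map_smul]
    module


/-- Spectral correspondence for the non-backtracking operator: with
`b_1, …, b_l` bounded operators on a complex Hilbert space `H`, an involution
`i ↦ i*` of the index set, `B` the operator on `H^{⊕l}` given by
`(Bx)_i = Σ_{j ≠ i*} b_j x_j`, and `λ ∈ ℂ` with `λ² ∉ spec(b_{i*} b_i)` for all `i`,
define `b_i(λ) = λ b_i (λ² − b_{i*}b_i)⁻¹`,
`b_0(λ) = −1 − Σ_i b_i (λ² − b_{i*}b_i)⁻¹ b_{i*}` and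
`A_λ = b_0(λ) + Σ_i b_i(λ)`. Then `λ ∈ spec(B)` iff `0 ∈ spec(A_λ)`. -/
theorem stmt16
    {H : Type*} [NormedAddCommGroup H] [InnerProductSpace ℂ H] [CompleteSpace H]
    (l : ℕ) (hl : 1 ≤ l)
    (b : Fin l → (H →L[ℂ] H))
    (star : Fin l → Fin l) (hstar : ∀ i, star (star i) = i)
    (B : (PiLp 2 fun _ : Fin l => H) →L[ℂ] (PiLp 2 fun _ : Fin l => H))
    (hB : ∀ x : PiLp 2 fun _ : Fin l => H, ∀ i : Fin l,
      B x i = ∑ j ∈ Finset.univ.filter fun j : Fin l => j ≠ star i, b j (x j))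
    (lam : ℂ)
    (hlam : ∀ i : Fin l, lam ^ 2 ∉ spectrum ℂ (b (star i) * b i)) :
    lam ∈ spectrum ℂ B ↔
      (0 : ℂ) ∈ spectrum ℂ
        ((-1 - ∑ i : Fin l,
            b i * Ring.inverse (lam ^ 2 • (1 : H →L[ℂ] H) - b (star i) * b i) * b (star i)) +
          ∑ i : Fin l,
            lam • (b i * Ring.inverse (lam ^ 2 • (1 : H →L[ℂ] H) - b (star i) * b i))) := by
  have hunit : ∀ i, IsUnit (lam ^ 2 • (1 : H →L[ℂ] H) - b (star i) * b i) := by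
    intro i
    have h := hlam i
    rw [spectrum.notMem_iff, Algebra.algebraMap_eq_smul_one] at h
    exact h
  set r : Fin l → H →L[ℂ] H :=
    fun i => Ring.inverse (lam ^ 2 • (1 : H →L[ℂ] H) - b (star i) * b i) with hrdef
  have hr : ∀ i v, lam ^ 2 • r i v - b (star i) (b i (r i v)) = v := fun i v => by
    simpa using DFunLike.congr_fun (Ring.mul_inverse_cancel _ (hunit i)) v
  have hr' : ∀ i v, r i (lam ^ 2 • v - b (star i) (b i v)) = v := fun i v => by
    simpa using DFunLike.congr_fun (Ring.inverse_mul_cancel _ (hunit i)) v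
  have hsolve := involution_system_iff (fun i => (b i : H →ₗ[ℂ] H)) (fun i => (r i : H →ₗ[ℂ] H))
    star hstar lam hr hr'
  simp only [ContinuousLinearMap.coe_coe] at hsolve
  have hB' : ∀ x i, B x i = ∑ j, b j (x j) - b (star i) (x (star i)) := by
    intro x i
    rw [hB, Finset.filter_ne', ← Finset.sum_erase_add _ _ (Finset.mem_univ (star i)),
      add_sub_cancel_right]
  have heq : ∀ x y : PiLp 2 fun _ : Fin l => H, lam • x - B x = y ↔
      ∀ i, x i = r i (lam • (∑ j, b j (x j) + y i)
        - b (star i) (∑ j, b j (x j) + y (star i))) := by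
    intro x y
    rw [← hsolve (fun i => x i) (fun i => ∑ j, b j (x j) + y i), PiLp.ext_iff]
    refine forall_congr' fun i => ?_
    rw [PiLp.sub_apply, PiLp.smul_apply, hB', sub_eq_iff_eq_add, ← sub_eq_zero,
      ← sub_eq_zero (a := _ + _)]
    refine Eq.congr ?_ rfl
    abel
  set A : H →L[ℂ] H := (-1 - ∑ i, b i * r i * b (star i)) + ∑ i, lam • (b i * r i) with hA
  have hAapp : ∀ s, A s = ∑ i, b i (r i (lam • s - b (star i) s)) - s := by
    intro s
    simp [hA, Finset.sum_sub_distrib]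
    abel
  have hcomb : ∀ s (y : Fin l → H),
      ∑ i, b i (r i (lam • (s + y i) - b (star i) (s + y (star i)))) =
        A s + s + ∑ i, b i (r i (lam • y i - b (star i) (y (star i)))) := by
    intro s y
    rw [hAapp, sub_add_cancel, ← Finset.sum_add_distrib]
    refine Finset.sum_congr rfl fun i _ => ?_
    rw [← map_add, ← map_add]
    congr 2
    rw [smul_add, map_add]
    abel
  have hsum : ∀ x y : PiLp 2 fun _ : Fin l => H, lam • x - B x = y →
      A (∑ j, b j (x j)) + ∑ i, b i (r i (lam • y i - b (star i) (y (star i)))) = 0 := by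
    intro x y h
    have h1 := hcomb (∑ j, b j (x j)) (fun i => y i)
    simp only [← (heq x y).1 h _] at h1
    rw [add_right_comm] at h1
    exact left_eq_add.1 (h1.trans (add_comm _ _))
  have hlift : ∀ (s : H) (y : PiLp 2 fun _ : Fin l => H),
      A s + ∑ i, b i (r i (lam • y i - b (star i) (y (star i)))) = 0 →
      ∃ x : PiLp 2 fun _ : Fin l => H, ∑ j, b j (x j) = s ∧ lam • x - B x = y := by
    intro s y h
    let x : PiLp 2 fun _ : Fin l => H :=
      WithLp.toLp 2 fun i => r i (lam • (s + y i) - b (star i) (s + y (star i)))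
    have hx : ∑ j, b j (x j) = s :=
      (hcomb s fun i => y i).trans (by rw [add_right_comm, h, zero_add])
    refine ⟨x, hx, (heq x y).2 fun i => ?_⟩
    rw [hx]
  have hAneg : IsUnit (algebraMap ℂ (H →L[ℂ] H) 0 - A) ↔ IsUnit A := by
    rw [map_zero, zero_sub, IsUnit.neg_iff]
  rw [spectrum.mem_iff, spectrum.mem_iff, hAneg, not_iff_not,
    ContinuousLinearMap.isUnit_iff_bijective, ContinuousLinearMap.isUnit_iff_bijective]
  have happ : ∀ x, (algebraMap ℂ _ lam - B) x = lam • x - B x := by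
    intro x
    simp [Algebra.algebraMap_eq_smul_one]
  simp only [Function.Bijective, injective_iff_map_eq_zero, Function.Surjective, happ]
  constructor
  · rintro ⟨hinj, hsurj⟩
    refine ⟨fun s hs => ?_, fun t => ?_⟩
    · obtain ⟨x, rfl, hx⟩ := hlift s 0 (by simp [hs])
      simp [hinj x hx]
    · obtain ⟨x, hx⟩ := hsurj (WithLp.toLp 2 fun _ => t)
      have h := hsum x _ hx
      have ht := hAapp t
      simp only at h
      refine ⟨-(∑ j, b j (x j) + t), ?_⟩
      rw [map_neg, map_add, ht, neg_eq_iff_add_eq_zero, add_assoc, sub_add_cancel, h]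
  · rintro ⟨hinj, hsurj⟩
    refine ⟨fun x hx => ?_, fun y => ?_⟩
    · have hs := hinj (∑ j, b j (x j)) (by simpa using hsum x 0 hx)
      ext i
      simpa [hs] using (heq x 0).1 hx i
    · obtain ⟨s, hs⟩ := hsurj (-∑ i, b i (r i (lam • y i - b (star i) (y (star i)))))
      obtain ⟨x, -, hx⟩ := hlift s y (by rw [hs, neg_add_cancel])
      exact ⟨x, hx⟩
end
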